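/- There exist constants η₁ > 0 and C_nrg > 0, depending only on the potential V, with the following property: for every ε with 0 < ε ≤ 1 and every solution u_ε of the vectorial Allen–Cahn system on the unit disk D², if E_ε(u_ε, D²) ≤ 2η₁ then there exists σ ∈ Σ such that |u_ε(x) − σ| ≤ μ₀/2 for every x in the disk D²(3/4) of radius 3/4, and moreover E_ε(u_ε, D²(5/8)) ≤ C_nrg · ε · E_ε(u_ε, D²). -/

import Mathlib

open MeasureTheory Metric Filter Topology Bornology
open scoped RealInnerProductSpace ENNReal Topology

noncomputable section

/-- The euclidean plane. -/
abbrev E2 : Type := EuclideanSpace ℝ (Fin 2)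

/-- The euclidean space `ℝ^k`. -/
abbrev Evec (k : ℕ) : Type := EuclideanSpace ℝ (Fin k)

/-- The `i`-th standard basis vector of the plane. -/
def b2 (i : Fin 2) : E2 := EuclideanSpace.single i (1 : ℝ)

/-- The partial derivative of `u` in the `i`-th coordinate direction. -/
def pder {k : ℕ} (u : E2 → Evec k) (i : Fin 2) (x : E2) : Evec k :=
  fderiv ℝ u x (b2 i)

/-- The Laplacian of a map defined on the plane. -/
def lap {k : ℕ} (u : E2 → Evec k) (x : E2) : Evec k :=
  ∑ i : Fin 2, fderiv ℝ (pder u i) x (b2 i)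

/-- `u` is a smooth solution of the vectorial Allen-Cahn system
`Δu = ε⁻² ∇V(u)` on the open set `U`. -/
def IsSolution {k : ℕ} (V : Evec k → ℝ) (ε : ℝ) (U : Set E2) (u : E2 → Evec k) : Prop :=
  ContDiffOn ℝ (⊤ : ℕ∞) u U ∧ ∀ x ∈ U, lap u x = (ε ^ 2)⁻¹ • gradient V (u x)

/-- The squared modulus `|∇u|²` of the full gradient. -/
def gradSq {k : ℕ} (u : E2 → Evec k) (x : E2) : ℝ :=
  ∑ i : Fin 2, ‖pder u i x‖ ^ 2

/-- The energy density `e_ε(u) = (ε/2)|∇u|² + ε⁻¹ V(u)`. -/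
def eDens {k : ℕ} (V : Evec k → ℝ) (ε : ℝ) (u : E2 → Evec k) (x : E2) : ℝ :=
  ε / 2 * gradSq u x + ε⁻¹ * V (u x)

/-- The energy `E_ε(u, G)`. -/
def energy {k : ℕ} (V : Evec k → ℝ) (ε : ℝ) (u : E2 → Evec k) (G : Set E2) : ℝ :=
  ∫ x in G, eDens V ε u x

/-- The hypotheses (H₁), (H₂), (H₃) on the multi-well potential `V`:
smooth, nonnegative with `inf V = 0`, finitely many zeros (at least two),
positive definite Hessian at each zero, quadratic growth of `y·∇V(y)` at
infinity and coercivity. -/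
structure IsMultiWell {k : ℕ} (V : Evec k → ℝ) : Prop where
  smooth : ContDiff ℝ (⊤ : ℕ∞) V
  nonneg : ∀ y, 0 ≤ V y
  finite_zeros : {y : Evec k | V y = 0}.Finite
  two_le_card : 2 ≤ {y : Evec k | V y = 0}.ncard
  hess_posdef : ∀ σ : Evec k, V σ = 0 → ∀ w : Evec k, w ≠ 0 →
    0 < iteratedFDeriv ℝ 2 V σ ![w, w]
  growth : ∃ α > (0 : ℝ), ∃ R > (0 : ℝ), ∀ y : Evec k, R < ‖y‖ →
    α * ‖y‖ ^ 2 ≤ ⟪y, gradient V y⟫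
  coercive : ∀ C : ℝ, ∃ R : ℝ, ∀ y : Evec k, R ≤ ‖y‖ → C ≤ V y

/-- Partial derivative, in the `i`-th coordinate direction, of a map from the plane to a
normed space. -/
def pd {F : Type*} [NormedAddCommGroup F] [NormedSpace ℝ F] (f : E2 → F) (i : Fin 2) (x : E2) : F :=
  fderiv ℝ f x (b2 i)

section PartialDerivatives

variable {F : Type*} [NormedAddCommGroup F] [NormedSpace ℝ F]

theorem contDiff_pd {f : E2 → F} (hf : ContDiff ℝ (⊤ : ℕ∞) f) (i : Fin 2) :
    ContDiff ℝ (⊤ : ℕ∞) (pd f i) :=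
  (hf.fderiv_right (m := ((⊤ : ℕ∞) : WithTop ℕ∞)) (by simp)).clm_apply contDiff_const

theorem diff_of_contDiff {G : Type*} [NormedAddCommGroup G] [NormedSpace ℝ G] {f : G → F}
    (hf : ContDiff ℝ (⊤ : ℕ∞) f) : Differentiable ℝ f :=
  hf.differentiable (by simp)

theorem pd_comm {f : E2 → F} (hf : ContDiff ℝ (⊤ : ℕ∞) f) (i j : Fin 2) (x : E2) :
    pd (pd f i) j x = pd (pd f j) i x := by
  have h1 : Differentiable ℝ (fderiv ℝ f) :=
    diff_of_contDiff (hf.fderiv_right (m := ((⊤ : ℕ∞) : WithTop ℕ∞)) (by simp))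
  have key : ∀ i j : Fin 2, pd (pd f i) j x = fderiv ℝ (fderiv ℝ f) x (b2 j) (b2 i) := by
    intro i j
    have := (h1 x).hasFDerivAt.clm_apply (hasFDerivAt_const (b2 i) x)
    unfold pd
    rw [this.fderiv]
    simp
  rw [key, key]
  have hs : IsSymmSndFDerivAt ℝ f x :=
    hf.contDiffAt.isSymmSndFDerivAt (by rw [minSmoothness_of_isRCLikeNormedField]; exact WithTop.coe_le_coe.2 (le_top : (2 : ℕ∞) ≤ ⊤))
  exact hs _ _

theorem pd_add {f g : E2 → F} {x : E2} (hf : DifferentiableAt ℝ f x)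
    (hg : DifferentiableAt ℝ g x) (i : Fin 2) :
    pd (fun y => f y + g y) i x = pd f i x + pd g i x := by
  have := (hf.hasFDerivAt.add hg.hasFDerivAt).fderiv
  unfold pd
  erw [this]; simp

theorem pd_sub {f g : E2 → F} {x : E2} (hf : DifferentiableAt ℝ f x)
    (hg : DifferentiableAt ℝ g x) (i : Fin 2) :
    pd (fun y => f y - g y) i x = pd f i x - pd g i x := by
  have := (hf.hasFDerivAt.sub hg.hasFDerivAt).fderiv
  unfold pd
  erw [this]; simp

theorem pd_const_mul {f : E2 → ℝ} {x : E2} (hf : DifferentiableAt ℝ f x) (c : ℝ) (i : Fin 2) :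
    pd (fun y => c * f y) i x = c * pd f i x := by
  unfold pd
  rw [(hf.hasFDerivAt.const_mul c).fderiv]; simp

theorem pd_mul {f g : E2 → ℝ} {x : E2} (hf : DifferentiableAt ℝ f x)
    (hg : DifferentiableAt ℝ g x) (i : Fin 2) :
    pd (fun y => f y * g y) i x = pd f i x * g x + f x * pd g i x := by
  unfold pd
  rw [(hf.hasFDerivAt.fun_mul hg.hasFDerivAt).fderiv]
  simp; ring

theorem pd_comp {G : Type*} [NormedAddCommGroup G] [NormedSpace ℝ G] {T : F → G} {f : E2 → F}
    {x : E2} (hT : DifferentiableAt ℝ T (f x)) (hf : DifferentiableAt ℝ f x) (i : Fin 2) :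
    pd (fun y => T (f y)) i x = fderiv ℝ T (f x) (pd f i x) := by
  unfold pd
  have := (hT.hasFDerivAt.comp x hf.hasFDerivAt).fderiv
  erw [this]; simp

theorem pd_inner {H : Type*} [NormedAddCommGroup H] [InnerProductSpace ℝ H] {f g : E2 → H} {x : E2}
    (hf : DifferentiableAt ℝ f x) (hg : DifferentiableAt ℝ g x) (i : Fin 2) :
    pd (fun y => ⟪f y, g y⟫) i x = ⟪pd f i x, g x⟫ + ⟪f x, pd g i x⟫ := by
  unfold pd
  rw [(hf.hasFDerivAt.inner ℝ hg.hasFDerivAt).fderiv]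
  simp [real_inner_comm, add_comm]

theorem pd_coord (i j : Fin 2) (x : E2) : pd (fun y : E2 => y j) i x = if i = j then 1 else 0 := by
  unfold pd
  have : (fun y : E2 => y j) = (EuclideanSpace.proj j : E2 →L[ℝ] ℝ) := by ext; rfl
  rw [this, ContinuousLinearMap.fderiv]
  simp [b2, eq_comm]

theorem pd_congr_of_eventuallyEq {f g : E2 → F} {x : E2} (h : f =ᶠ[𝓝 x] g) (i : Fin 2) :
    pd f i x = pd g i x := by
  unfold pd
  rw [h.fderiv_eq]

theorem pd_pd_congr_of_eventuallyEq {f g : E2 → F} {x : E2} (h : f =ᶠ[𝓝 x] g) (i : Fin 2) :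
    pd (pd f i) i x = pd (pd g i) i x := by
  apply pd_congr_of_eventuallyEq
  filter_upwards [eventually_eventually_nhds.2 h] with y hy
  exact pd_congr_of_eventuallyEq hy i

theorem pd_const (c : F) (i : Fin 2) (x : E2) : pd (fun _ : E2 => c) i x = 0 := by
  unfold pd; simp

theorem integral_pd_eq_zero {G : E2 → ℝ} (hG : ContDiff ℝ (⊤ : ℕ∞) G) (hc : HasCompactSupport G)
    (i : Fin 2) : ∫ x, pd G i x = 0 := by
  have hc' : HasCompactSupport (pd G i) := hc.fderiv_apply ℝ (b2 i)
  have h1 : Integrable (pd G i) :=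
    (contDiff_pd hG i).continuous.integrable_of_hasCompactSupport hc'
  have h2 : Integrable G := hG.continuous.integrable_of_hasCompactSupport hc
  have := integral_mul_fderiv_eq_neg_fderiv_mul_of_integrable (μ := (volume : Measure E2))
    (f := fun _ : E2 => (1 : ℝ)) (g := G) (v := b2 i) (by simp) (by simp only [one_mul]; exact h1)
    (by simpa using h2) (fun x _ => differentiableAt_const _)
    (fun x _ => diff_of_contDiff hG x)
  simpa [pd] using this

theorem hasDerivAt_line {f : E2 → F} (hf : Differentiable ℝ f) (x : E2) (i : Fin 2) (t : ℝ) :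
    HasDerivAt (fun s : ℝ => f (x + s • b2 i)) (pd f i (x + t • b2 i)) t := by
  have h1 : HasDerivAt (fun s : ℝ => x + s • b2 i) (b2 i) t := by
    simpa using ((hasDerivAt_id t).smul_const (b2 i)).const_add x
  exact (hf _).hasFDerivAt.comp_hasDerivAt t h1

theorem pd_pd_nonpos_of_isLocalMax {g : E2 → ℝ} (hg : ContDiff ℝ (⊤ : ℕ∞) g) {x : E2}
    (hx : IsLocalMax g x) (i : Fin 2) : pd (pd g i) i x ≤ 0 := by
  by_contra! hpos
  set h : ℝ → ℝ := fun s => g (x + s • b2 i) with hh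
  have hd : deriv h = fun t => pd g i (x + t • b2 i) :=
    funext fun t => (hasDerivAt_line (diff_of_contDiff hg) x i t).deriv
  have hdd : deriv (deriv h) = fun t => pd (pd g i) i (x + t • b2 i) := by
    rw [hd]
    exact funext fun t => (hasDerivAt_line (diff_of_contDiff (contDiff_pd hg i)) x i t).deriv
  have hcont : Continuous fun s : ℝ => x + s • b2 i := by fun_prop
  have hmax : IsLocalMax h 0 := by
    have : Tendsto (fun s : ℝ => x + s • b2 i) (𝓝 0) (𝓝 x) := by
      simpa using hcont.tendsto 0
    have := this.eventually hx
    simpa [IsLocalMax, IsMaxFilter, hh] using this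
  have hmin : IsLocalMin h 0 := by
    apply isLocalMin_of_deriv_deriv_pos
    · rw [hdd]; simpa using hpos
    · exact hmax.deriv_eq_zero
    · exact (hg.continuous.comp hcont).continuousAt
  have hconst : h =ᶠ[𝓝 0] fun _ => h 0 := by
    filter_upwards [hmax, hmin] with s h1 h2 using le_antisymm h1 h2
  have h1 : deriv h =ᶠ[𝓝 0] deriv fun _ => h 0 := hconst.deriv
  have h2 := h1.deriv_eq
  rw [hdd] at h2
  simp at h2
  linarith

end PartialDerivatives

section MaximumPrinciple

theorem le_of_laplacian_pos {g : E2 → ℝ} (hg : ContDiff ℝ (⊤ : ℕ∞) g) {a b : Fin 2 → ℝ} {B : ℝ}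
    (hint : ∀ x : E2, (∀ i, a i < x i ∧ x i < b i) → B < g x → 0 < ∑ i, pd (pd g i) i x)
    (hbd : ∀ x : E2, (∀ i, a i ≤ x i ∧ x i ≤ b i) → (∃ i, x i = a i ∨ x i = b i) → g x ≤ B)
    (x : E2) (hx : ∀ i, a i ≤ x i ∧ x i ≤ b i) : g x ≤ B := by
  set K : Set E2 := {x | ∀ i, a i ≤ x i ∧ x i ≤ b i} with hK
  have hKeq : K = (EuclideanSpace.equiv (Fin 2) ℝ).toHomeomorph ⁻¹' (Set.Icc a b) := by
    ext y
    simp only [hK, Set.mem_ofPred_eq, Set.mem_preimage, Set.mem_Icc, Pi.le_def, ← forall_and]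
    rfl
  have hKc : IsCompact K := by
    rw [hKeq]
    exact (Homeomorph.isCompact_preimage _).2 isCompact_Icc
  obtain ⟨z, hz, hmax⟩ := hKc.exists_isMaxOn ⟨x, hx⟩ hg.continuous.continuousOn
  refine (hmax hx).trans ?_
  by_contra! hB
  by_cases hzb : ∃ i, z i = a i ∨ z i = b i
  · exact absurd (hbd z hz hzb) (not_le.2 hB)
  · push Not at hzb
    have hzi : ∀ i, a i < z i ∧ z i < b i := fun i =>
      ⟨lt_of_le_of_ne (hz i).1 (hzb i).1.symm, lt_of_le_of_ne (hz i).2 (hzb i).2⟩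
    have hlm : IsLocalMax g z := by
      have hev : ∀ᶠ y in 𝓝 z, ∀ i, a i < y i ∧ y i < b i := by
        rw [eventually_all]
        intro i
        have hc : Continuous fun y : E2 => y i := by fun_prop
        exact (hc.continuousAt.eventually (lt_mem_nhds (hzi i).1)).and
          (hc.continuousAt.eventually (gt_mem_nhds (hzi i).2))
      filter_upwards [hev] with y hy
      exact hmax (fun i => ⟨(hy i).1.le, (hy i).2.le⟩)
    have h1 := hint z hzi hB
    have h2 : ∑ i, pd (pd g i) i z ≤ 0 :=
      Finset.sum_nonpos fun i _ => pd_pd_nonpos_of_isLocalMax hg hlm i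
    linarith

theorem pd_comp_affine {F : Type*} [NormedAddCommGroup F] [NormedSpace ℝ F] {f : E2 → F}
    (hf : Differentiable ℝ f) {L : E2 →L[ℝ] E2} {s : Fin 2 → ℝ}
    (hL : ∀ j, L (b2 j) = s j • b2 j) (c : E2) (j : Fin 2) :
    pd (fun y => f (c + L y)) j = fun x => s j • pd f j (c + L x) := by
  funext x
  have h1 : HasFDerivAt (fun y => c + L y) L x := L.hasFDerivAt.const_add c
  have h2 : HasFDerivAt (fun y => f (c + L y)) ((fderiv ℝ f (c + L x)).comp L) x :=
    (hf _).hasFDerivAt.comp x h1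
  unfold pd
  rw [h2.fderiv]
  simp [hL]

theorem pd_pd_comp_affine {F : Type*} [NormedAddCommGroup F] [NormedSpace ℝ F] {f : E2 → F}
    (hf : ContDiff ℝ (⊤ : ℕ∞) f) {L : E2 →L[ℝ] E2} {s : Fin 2 → ℝ}
    (hL : ∀ j, L (b2 j) = s j • b2 j) (c : E2) (j : Fin 2) (x : E2) :
    pd (pd (fun y => f (c + L y)) j) j x = (s j ^ 2) • pd (pd f j) j (c + L x) := by
  rw [pd_comp_affine (diff_of_contDiff hf) hL]
  have h1 := congrFun (pd_comp_affine (diff_of_contDiff (contDiff_pd hf j)) hL c j) x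
  have hd : DifferentiableAt ℝ (fun y => pd f j (c + L y)) x := by
    have := diff_of_contDiff (contDiff_pd hf j)
    exact (this _).comp x (by fun_prop)
  have h2 : pd (fun y => s j • pd f j (c + L y)) j x
      = s j • pd (fun y => pd f j (c + L y)) j x := by
    unfold pd
    rw [fderiv_fun_const_smul (by exact hd)]
    simp
  rw [h2, h1, smul_smul, sq]

theorem pd_pd_sub {f g : E2 → ℝ} (hf : ContDiff ℝ (⊤ : ℕ∞) f) (hg : ContDiff ℝ (⊤ : ℕ∞) g)
    (i : Fin 2) (x : E2) :
    pd (pd (fun y => f y - g y) i) i x = pd (pd f i) i x - pd (pd g i) i x := by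
  have : pd (fun y => f y - g y) i = fun y => pd f i y - pd g i y :=
    funext fun y => pd_sub (diff_of_contDiff hf y) (diff_of_contDiff hg y) i
  rw [this]
  exact pd_sub (diff_of_contDiff (contDiff_pd hf i) x) (diff_of_contDiff (contDiff_pd hg i) x) i

theorem pd_pd_add {f g : E2 → ℝ} (hf : ContDiff ℝ (⊤ : ℕ∞) f) (hg : ContDiff ℝ (⊤ : ℕ∞) g)
    (i : Fin 2) (x : E2) :
    pd (pd (fun y => f y + g y) i) i x = pd (pd f i) i x + pd (pd g i) i x := by
  have : pd (fun y => f y + g y) i = fun y => pd f i y + pd g i y :=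
    funext fun y => pd_add (diff_of_contDiff hf y) (diff_of_contDiff hg y) i
  rw [this]
  exact pd_add (diff_of_contDiff (contDiff_pd hf i) x) (diff_of_contDiff (contDiff_pd hg i) x) i

theorem pd_pd_const_mul {f : E2 → ℝ} (hf : ContDiff ℝ (⊤ : ℕ∞) f) (c : ℝ)
    (i : Fin 2) (x : E2) :
    pd (pd (fun y => c * f y) i) i x = c * pd (pd f i) i x := by
  have : pd (fun y => c * f y) i = fun y => c * pd f i y :=
    funext fun y => pd_const_mul (diff_of_contDiff hf y) c i
  rw [this]
  exact pd_const_mul (diff_of_contDiff (contDiff_pd hf i) x) c i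

theorem contDiff_coord (j : Fin 2) : ContDiff ℝ (⊤ : ℕ∞) fun y : E2 => y j :=
  (EuclideanSpace.proj j : E2 →L[ℝ] ℝ).contDiff

theorem pd_pd_coord (i j : Fin 2) (x : E2) : pd (pd (fun y : E2 => y j) i) i x = 0 := by
  have : pd (fun y : E2 => y j) i = fun _ => if i = j then 1 else 0 := funext (pd_coord i j)
  rw [this, pd_const]

theorem pd_pd_coord_sq (i j : Fin 2) (x : E2) :
    pd (pd (fun y : E2 => y j * y j) i) i x = if i = j then 2 else 0 := by
  have hd := diff_of_contDiff (contDiff_coord j)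
  have : pd (fun y : E2 => y j * y j) i = fun y => (2 * if i = j then 1 else 0) * y j := by
    funext y
    rw [pd_mul (hd y) (hd y), pd_coord]; ring
  rw [this, pd_const_mul (hd x), pd_coord]
  split_ifs <;> norm_num

theorem fin2_cases (i : Fin 2) (P : Fin 2 → Prop) (h1 : P i) (h2 : P (1 - i)) (j : Fin 2) :
    P j := by
  fin_cases i <;> fin_cases j <;> first | exact h1 | exact h2

/-- Interior gradient bound for a function with bounded Laplacian on a square, obtained from a
barrier for the odd part of the function. -/
theorem pd_le_of_laplacian_bound {w : E2 → ℝ} (hw : ContDiff ℝ (⊤ : ℕ∞) w) {d M N : ℝ}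
    (hd : 0 < d) (hM : ∀ x : E2, (∀ i, |x i| ≤ d) → |w x| ≤ M)
    (hN : ∀ x : E2, (∀ i, |x i| ≤ d) → |∑ i, pd (pd w i) i x| < N) (i : Fin 2) :
    pd w i 0 ≤ 2 * M / d + N * d / 2 := by
  have hne : (1 - i : Fin 2) ≠ i := by fin_cases i <;> decide
  have hM0 : 0 ≤ M := (abs_nonneg _).trans (hM 0 (by simp [hd.le]))
  have hN0 : 0 ≤ N := (abs_nonneg _).trans (hN 0 (by simp [hd.le])).le
  set L : E2 →L[ℝ] E2 :=
    ContinuousLinearMap.id ℝ E2 - (2 : ℝ) • (EuclideanSpace.proj i : E2 →L[ℝ] ℝ).smulRight (b2 i)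
    with hLdef
  have hLapp : ∀ x : E2, ∀ j, (L x) j = if j = i then - x i else x j := by
    intro x j
    simp only [hLdef, b2]
    by_cases h : j = i
    · subst h; simp; ring
    · simp [h]
  set s : Fin 2 → ℝ := fun j => if j = i then -1 else 1 with hs
  have hL : ∀ j, L (b2 j) = s j • b2 j := by
    intro j
    ext m
    rw [hLapp]
    by_cases h : j = i
    · subst h
      by_cases h' : m = j <;> simp [hs, b2, h']
    · have h' : ¬ i = j := fun h'' => h h''.symm
      by_cases h'' : m = i
      · subst h''
        simp [hs, b2, h, h']
      · simp [hs, b2, h, h'']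
  have hs2 : ∀ j, s j ^ 2 = 1 := by intro j; simp only [hs]; split_ifs <;> norm_num
  set w' : E2 → ℝ := fun x => w (0 + L x) with hw'
  have hw's : ContDiff ℝ (⊤ : ℕ∞) w' := hw.comp (contDiff_const.add L.contDiff)
  set φ : E2 → ℝ := fun x => 2⁻¹ * (w x - w' x) with hφ
  have hφs : ContDiff ℝ (⊤ : ℕ∞) φ := contDiff_const.mul (hw.sub hw's)
  set α := M / d ^ 2
  have hα : 0 ≤ α := by positivity
  have hαd : α * d ^ 2 = M := by simp only [α]; field_simp
  set ψ : E2 → ℝ := fun x => α * (x (1 - i) * x (1 - i)) +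
    (-(α + N / 2) * (x i * x i) + (2 * d * α + N / 2 * d) * x i) with hψ
  have c1 := contDiff_coord i
  have c2 := contDiff_coord (1 - i)
  have hψ1 : ContDiff ℝ (⊤ : ℕ∞) fun x : E2 => α * (x (1 - i) * x (1 - i)) :=
    contDiff_const.mul (c2.mul c2)
  have hψ2 : ContDiff ℝ (⊤ : ℕ∞) fun x : E2 => -(α + N / 2) * (x i * x i) :=
    contDiff_const.mul (c1.mul c1)
  have hψ3 : ContDiff ℝ (⊤ : ℕ∞) fun x : E2 => (2 * d * α + N / 2 * d) * x i :=
    contDiff_const.mul c1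
  have hψs : ContDiff ℝ (⊤ : ℕ∞) ψ := hψ1.add (hψ2.add hψ3)
  have hlapψ : ∀ x, ∑ j, pd (pd ψ j) j x = - N := by
    intro x
    have : ∀ j, pd (pd ψ j) j x = α * (if j = 1 - i then 2 else 0)
        + -(α + N / 2) * (if j = i then 2 else 0) := by
      intro j
      simp only [hψ]
      rw [pd_pd_add hψ1 (hψ2.add hψ3), pd_pd_add hψ2 hψ3, pd_pd_const_mul (c2.mul c2),
        pd_pd_const_mul (c1.mul c1), pd_pd_const_mul c1, pd_pd_coord_sq, pd_pd_coord_sq,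
        pd_pd_coord]
      ring
    simp_rw [this]
    rw [Finset.sum_add_distrib, ← Finset.mul_sum, ← Finset.mul_sum]
    simp
    ring
  have hsq : ∀ x : E2, (∀ j, |x j| ≤ d) → ∀ j, |(0 + L x) j| ≤ d := by
    intro x hx j
    rw [zero_add, hLapp]
    split_ifs
    · rw [abs_neg]; exact hx i
    · exact hx j
  have hlapφ : ∀ x : E2, (∀ j, |x j| ≤ d) → - N < ∑ j, pd (pd φ j) j x := by
    intro x hx
    have : ∀ j, pd (pd φ j) j x = 2⁻¹ * (pd (pd w j) j x - pd (pd w j) j (0 + L x)) := by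
      intro j
      simp only [hφ]
      rw [pd_pd_const_mul (hw.sub hw's), pd_pd_sub hw hw's, pd_pd_comp_affine hw hL, hs2, one_smul]
    simp_rw [this]
    rw [← Finset.mul_sum, Finset.sum_sub_distrib]
    have h1 := abs_lt.1 (hN x hx)
    have h2 := abs_lt.1 (hN _ (hsq x hx))
    linarith [h1.1, h2.2]
  set a : Fin 2 → ℝ := fun j => if j = i then 0 else -d with ha
  set b : Fin 2 → ℝ := fun _ => d with hb
  have hrect : ∀ x : E2, (∀ j, a j ≤ x j ∧ x j ≤ b j) → (∀ j, |x j| ≤ d) ∧ 0 ≤ x i := by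
    intro x hx
    refine ⟨fun j => abs_le.2 ⟨?_, (hx j).2⟩, by simpa [ha] using (hx i).1⟩
    have := (hx j).1
    simp only [ha] at this
    split_ifs at this <;> linarith
  have key := le_of_laplacian_pos (hφs.sub hψs) (a := a) (b := b) (B := 0) (by
    intro x hx _
    have hx' := (hrect x fun j => ⟨(hx j).1.le, (hx j).2.le⟩).1
    simp_rw [pd_pd_sub hφs hψs]
    rw [Finset.sum_sub_distrib, hlapψ]
    linarith [hlapφ x hx']) (by
    intro x hx hxb
    obtain ⟨hx1, hx2⟩ := hrect x hx
    have hxi : x i ≤ d := (hx i).2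
    have hφM : φ x ≤ M := by
      have h1 := abs_le.1 (hM x hx1)
      have h2 := abs_le.1 (hM _ (hsq x hx1))
      simp only [hφ, hw']
      linarith [h1.2, h2.1]
    have hrest : 0 ≤ N / 2 * (x i * (d - x i)) := by
      have : 0 ≤ d - x i := by linarith
      positivity
    have hxid : 0 ≤ α * (x i * (2 * d - x i)) := by
      have : 0 ≤ 2 * d - x i := by linarith
      positivity
    have hψe : ψ x = α * (x (1 - i) * x (1 - i)) + α * (x i * (2 * d - x i))
        + N / 2 * (x i * (d - x i)) := by simp only [hψ]; ring
    have hsq1 : 0 ≤ α * (x (1 - i) * x (1 - i)) := mul_nonneg hα (mul_self_nonneg _)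
    show φ x - ψ x ≤ 0
    obtain ⟨j, hj⟩ := hxb
    revert hj
    apply fin2_cases i (fun j => (x j = a j ∨ x j = b j) → φ x - ψ x ≤ 0)
    · rintro (hj | hj)
      · have h0 : x i = 0 := by simpa [ha] using hj
        have hLx : 0 + L x = x := by
          ext m
          rw [zero_add, hLapp]
          split_ifs with h
          · rw [h, h0, neg_zero]
          · rfl
        have : φ x = 0 := by simp only [hφ, hw', hLx]; ring
        linarith
      · have h0 : x i = d := hj
        rw [h0] at hψe
        have : α * (d * (2 * d - d)) = M := by rw [← hαd]; ring
        have : N / 2 * (d * (d - d)) = 0 := by ring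
        linarith
    · intro hj
      have h0 : x (1 - i) * x (1 - i) = d ^ 2 := by
        rcases hj with hj | hj
        · rw [hj]; simp [ha, hne]; ring
        · rw [hj]; simp only [hb]; ring
      rw [h0, hαd] at hψe
      linarith)
  have hbi : ∀ t : ℝ, ∀ j, (t • b2 i : E2) j = if j = i then t else 0 := by
    intro t j
    simp [b2]
  have hline : ∀ t : ℝ, 0 < t → t ≤ d →
      t⁻¹ • (φ (0 + t • b2 i) - φ (0 + (0:ℝ) • b2 i)) ≤ 2 * M / d + N * d / 2 := by
    intro t ht htd
    have h1 := key (t • b2 i) (by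
      intro j
      rw [hbi]
      simp only [ha, hb]
      split_ifs
      · exact ⟨ht.le, htd⟩
      · exact ⟨by linarith, hd.le⟩)
    have h2 : φ (0 + (0:ℝ) • b2 i) = 0 := by simp [hφ, hw']
    rw [h2, sub_zero, zero_add, smul_eq_mul, inv_mul_le_iff₀ ht]
    have h3 : ψ (t • b2 i) ≤ t * (2 * M / d + N * d / 2) := by
      simp only [hψ, hbi, hne, if_true, if_false]
      have : 2 * M / d = 2 * d * α := by simp only [α]; field_simp
      rw [this]
      nlinarith [mul_nonneg (add_nonneg hα (by positivity : 0 ≤ N / 2)) (mul_self_nonneg t)]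
    have h4 : φ (t • b2 i) - ψ (t • b2 i) ≤ 0 := h1
    linarith
  have hder := hasDerivAt_line (diff_of_contDiff hφs) 0 i 0
  have hlim := hder.tendsto_slope_zero_right
  have hpdφ : pd φ i (0 + (0:ℝ) • b2 i) = pd w i 0 := by
    have hdw := diff_of_contDiff hw
    have hdw' := diff_of_contDiff hw's
    simp only [zero_smul, add_zero, hφ]
    rw [pd_const_mul ((hdw 0).fun_sub (hdw' 0)), pd_sub (hdw 0) (hdw' 0),
      pd_comp_affine hdw hL]
    simp [hs]
    ring
  rw [hpdφ] at hlim
  refine le_of_tendsto hlim ?_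
  filter_upwards [Ioc_mem_nhdsGT hd] with t ht
  simpa using hline t ht.1 ht.2

end MaximumPrinciple

section IntegralIdentities

variable {k : ℕ}

theorem fderiv_apply_eq_inner_gradient {V : Evec k → ℝ} (hV : ContDiff ℝ (⊤ : ℕ∞) V)
    (y w : Evec k) : fderiv ℝ V y w = ⟪gradient V y, w⟫ := by
  have := (diff_of_contDiff hV y).hasGradientAt.hasFDerivAt.fderiv
  rw [this]
  simp

theorem continuous_gradient {V : Evec k → ℝ} (hV : ContDiff ℝ (⊤ : ℕ∞) V) :
    Continuous (gradient V) := by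
  unfold gradient
  exact (LinearIsometryEquiv.continuous _).comp (hV.continuous_fderiv (by simp))

theorem integral_eq_neg_of_divergence {G₀ G₁ A B : E2 → ℝ} (h0 : ContDiff ℝ (⊤ : ℕ∞) G₀)
    (h1 : ContDiff ℝ (⊤ : ℕ∞) G₁) (hc0 : HasCompactSupport G₀) (hc1 : HasCompactSupport G₁)
    (hA : Continuous A) (hAc : HasCompactSupport A)
    (h : ∀ x, pd G₀ 0 x + pd G₁ 1 x = A x + B x) : ∫ x, A x = - ∫ x, B x := by
  have i0 : Integrable (pd G₀ 0) := (contDiff_pd h0 0).continuous.integrable_of_hasCompactSupport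
    (hc0.fderiv_apply ℝ (b2 0))
  have i1 : Integrable (pd G₁ 1) := (contDiff_pd h1 1).continuous.integrable_of_hasCompactSupport
    (hc1.fderiv_apply ℝ (b2 1))
  have iA : Integrable A := hA.integrable_of_hasCompactSupport hAc
  have hB : B = fun x => (pd G₀ 0 x + pd G₁ 1 x) - A x := by
    funext x; rw [h x]; ring
  have h2 : ∫ x, B x = (∫ x, pd G₀ 0 x) + (∫ x, pd G₁ 1 x) - ∫ x, A x := by
    rw [hB, ← integral_add i0 i1]
    exact integral_sub (i0.add i1) iA
  rw [h2, integral_pd_eq_zero h0 hc0, integral_pd_eq_zero h1 hc1]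
  ring

/-- The equation tested against `ψ T(v)`. -/
theorem integral_test_eq {V : Evec k → ℝ} (hV : ContDiff ℝ (⊤ : ℕ∞) V) {v : E2 → Evec k}
    (hv : ContDiff ℝ (⊤ : ℕ∞) v) {T : Evec k → Evec k} (hT : ContDiff ℝ (⊤ : ℕ∞) T)
    {ψ : E2 → ℝ} (hψ : ContDiff ℝ (⊤ : ℕ∞) ψ) (hψc : HasCompactSupport ψ)
    (hpde : ∀ x, ψ x ≠ 0 → ∑ i, pd (pd v i) i x = gradient V (v x)) :
    ∫ x, ψ x * (⟪fderiv ℝ T (v x) (pd v 0 x), pd v 0 x⟫ + ⟪fderiv ℝ T (v x) (pd v 1 x), pd v 1 x⟫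
        + ⟪gradient V (v x), T (v x)⟫)
      = - ∫ x, (pd ψ 0 x * ⟪pd v 0 x, T (v x)⟫ + pd ψ 1 x * ⟪pd v 1 x, T (v x)⟫) := by
  have hTv : ContDiff ℝ (⊤ : ℕ∞) fun x => T (v x) := hT.comp hv
  have hin : ∀ i, ContDiff ℝ (⊤ : ℕ∞) fun x => ⟪pd v i x, T (v x)⟫ := fun i =>
    (contDiff_pd hv i).inner ℝ hTv
  have hp : ∀ i, Continuous (pd v i) := fun i => (contDiff_pd hv i).continuous
  have hG : ∀ i, ContDiff ℝ (⊤ : ℕ∞) fun x => ψ x * ⟪pd v i x, T (v x)⟫ := fun i =>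
    hψ.mul (hin i)
  have hdT : Continuous (fderiv ℝ T) := hT.continuous_fderiv (by simp)
  have hgV := continuous_gradient hV
  have hvc := hv.continuous
  have hTc := hT.continuous
  have hψcont := hψ.continuous
  refine integral_eq_neg_of_divergence (hG 0) (hG 1) hψc.mul_right hψc.mul_right ?_
    hψc.mul_right ?_
  · have h0 : ∀ i, Continuous fun x => fderiv ℝ T (v x) (pd v i x) := fun i =>
      (hdT.comp hvc).clm_apply (hp i)
    exact hψcont.mul (((h0 0).inner (hp 0)).add ((h0 1).inner (hp 1)) |>.add
      ((hgV.comp hvc).inner (hTc.comp hvc)))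
  · intro x
    have hd : ∀ i, pd (fun x => ψ x * ⟪pd v i x, T (v x)⟫) i x
        = pd ψ i x * ⟪pd v i x, T (v x)⟫ + ψ x * (⟪pd (pd v i) i x, T (v x)⟫
          + ⟪pd v i x, fderiv ℝ T (v x) (pd v i x)⟫) := by
      intro i
      rw [pd_mul (diff_of_contDiff hψ x) (diff_of_contDiff (hin i) x),
        pd_inner (diff_of_contDiff (contDiff_pd hv i) x) (diff_of_contDiff hTv x),
        pd_comp (diff_of_contDiff hT _) (diff_of_contDiff hv x)]
    rw [hd, hd]
    have key : ψ x * (⟪pd (pd v 0) 0 x, T (v x)⟫ + ⟪pd (pd v 1) 1 x, T (v x)⟫)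
        = ψ x * ⟪gradient V (v x), T (v x)⟫ := by
      by_cases h : ψ x = 0
      · simp [h]
      · rw [← hpde x h, Fin.sum_univ_two, inner_add_left]
    rw [real_inner_comm (pd v 0 x) (fderiv ℝ T (v x) (pd v 0 x)),
      real_inner_comm (pd v 1 x) (fderiv ℝ T (v x) (pd v 1 x))] at *
    linear_combination key

/-- The Pohozaev identity for the vector field `ψ(x) x`. -/
theorem integral_pohozaev {V : Evec k → ℝ} (hV : ContDiff ℝ (⊤ : ℕ∞) V) {v : E2 → Evec k}
    (hv : ContDiff ℝ (⊤ : ℕ∞) v) {ψ : E2 → ℝ} (hψ : ContDiff ℝ (⊤ : ℕ∞) ψ)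
    (hψc : HasCompactSupport ψ)
    (hpde : ∀ x, ψ x ≠ 0 → ∑ i, pd (pd v i) i x = gradient V (v x)) :
    ∫ x, ψ x * (2 * V (v x))
      = - ∫ x, (pd ψ 0 x * (x 0 * (2⁻¹ * (⟪pd v 1 x, pd v 1 x⟫ - ⟪pd v 0 x, pd v 0 x⟫) + V (v x))
            - x 1 * ⟪pd v 0 x, pd v 1 x⟫)
          + pd ψ 1 x * (x 1 * (2⁻¹ * (⟪pd v 0 x, pd v 0 x⟫ - ⟪pd v 1 x, pd v 1 x⟫) + V (v x))
            - x 0 * ⟪pd v 0 x, pd v 1 x⟫)) := by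
  have hp : ∀ i, ContDiff ℝ (⊤ : ℕ∞) (pd v i) := fun i => contDiff_pd hv i
  have hpp : ∀ i j, ContDiff ℝ (⊤ : ℕ∞) fun x => ⟪pd v i x, pd v j x⟫ := fun i j =>
    (hp i).inner ℝ (hp j)
  have hVv : ContDiff ℝ (⊤ : ℕ∞) fun x => V (v x) := hV.comp hv
  have hx := contDiff_coord
  have ha : ∀ i j, ContDiff ℝ (⊤ : ℕ∞) fun x =>
      2⁻¹ * (⟪pd v i x, pd v i x⟫ - ⟪pd v j x, pd v j x⟫) + V (v x) := fun i j =>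
    (contDiff_const.mul ((hpp i i).sub (hpp j j))).add hVv
  have hb : ∀ i j l, ContDiff ℝ (⊤ : ℕ∞) fun x : E2 =>
      x l * (2⁻¹ * (⟪pd v i x, pd v i x⟫ - ⟪pd v j x, pd v j x⟫) + V (v x)) := fun i j l =>
    (hx l).mul (ha i j)
  have hc : ∀ l, ContDiff ℝ (⊤ : ℕ∞) fun x : E2 => x l * ⟪pd v 0 x, pd v 1 x⟫ := fun l =>
    (hx l).mul (hpp 0 1)
  have hd : ∀ i j l m, ContDiff ℝ (⊤ : ℕ∞) fun x : E2 =>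
      x l * (2⁻¹ * (⟪pd v i x, pd v i x⟫ - ⟪pd v j x, pd v j x⟫) + V (v x))
        - x m * ⟪pd v 0 x, pd v 1 x⟫ := fun i j l m => (hb i j l).sub (hc m)
  refine integral_eq_neg_of_divergence (hψ.mul (hd 1 0 0 1)) (hψ.mul (hd 0 1 1 0))
    hψc.mul_right hψc.mul_right ?_ hψc.mul_right ?_
  · exact hψ.continuous.mul (continuous_const.mul hVv.continuous)
  · intro x
    have e : ∀ i j l m, ∀ n, pd (fun x : E2 =>
        x l * (2⁻¹ * (⟪pd v i x, pd v i x⟫ - ⟪pd v j x, pd v j x⟫) + V (v x))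
          - x m * ⟪pd v 0 x, pd v 1 x⟫) n x
        = (if n = l then 1 else 0) *
            (2⁻¹ * (⟪pd v i x, pd v i x⟫ - ⟪pd v j x, pd v j x⟫) + V (v x))
          + x l * (2⁻¹ * ((⟪pd (pd v i) n x, pd v i x⟫ + ⟪pd v i x, pd (pd v i) n x⟫)
              - (⟪pd (pd v j) n x, pd v j x⟫ + ⟪pd v j x, pd (pd v j) n x⟫))
            + ⟪gradient V (v x), pd v n x⟫)
          - ((if n = m then 1 else 0) * ⟪pd v 0 x, pd v 1 x⟫
            + x m * (⟪pd (pd v 0) n x, pd v 1 x⟫ + ⟪pd v 0 x, pd (pd v 1) n x⟫)) := by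
      intro i j l m n
      have dp : ∀ i, DifferentiableAt ℝ (pd v i) x := fun i => diff_of_contDiff (hp i) x
      have dpp : ∀ i j, DifferentiableAt ℝ (fun x => ⟪pd v i x, pd v j x⟫) x := fun i j =>
        diff_of_contDiff (hpp i j) x
      rw [pd_sub (diff_of_contDiff (hb i j l) x) (diff_of_contDiff (hc m) x),
        pd_mul (diff_of_contDiff (hx l) x) (diff_of_contDiff (ha i j) x),
        pd_mul (diff_of_contDiff (hx m) x) (dpp 0 1), pd_coord, pd_coord,
        pd_add (((dpp i i).fun_sub (dpp j j)).const_mul _) (diff_of_contDiff hVv x),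
        pd_const_mul ((dpp i i).fun_sub (dpp j j)), pd_sub (dpp i i) (dpp j j),
        pd_inner (dp i) (dp i), pd_inner (dp j) (dp j), pd_inner (dp 0) (dp 1),
        pd_comp (diff_of_contDiff hV _) (diff_of_contDiff hv x),
        fderiv_apply_eq_inner_gradient hV]
    rw [pd_mul (diff_of_contDiff hψ x) (diff_of_contDiff (hd 1 0 0 1) x),
      pd_mul (diff_of_contDiff hψ x) (diff_of_contDiff (hd 0 1 1 0) x), e, e]
    by_cases h : ψ x = 0
    · simp [h]
    · have h1 := hpde x h
      rw [Fin.sum_univ_two] at h1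
      rw [← h1, pd_comm hv 1 0]
      simp only [inner_add_left, if_true, zero_ne_one, one_ne_zero, if_false]
      rw [real_inner_comm (pd v 0 x) (pd (pd v 0) 1 x), real_inner_comm (pd v 0 x) (pd (pd v 1) 1 x),
        real_inner_comm (pd v 0 x) (pd (pd v 0) 0 x), real_inner_comm (pd v 1 x) (pd (pd v 0) 1 x),
        real_inner_comm (pd v 1 x) (pd (pd v 1) 1 x), real_inner_comm (pd v 1 x) (pd (pd v 0) 0 x)]
      ring

end IntegralIdentities

section Potential

variable {k : ℕ}

theorem one_dim_convexity {g g' g'' : ℝ → ℝ} {m : ℝ} (hm : 0 ≤ m)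
    (h1 : ∀ t, HasDerivAt g (g' t) t) (h2 : ∀ t, HasDerivAt g' (g'' t) t)
    (hg : ∀ t ∈ Set.Icc (0 : ℝ) 1, m ≤ g'' t) (h0 : g 0 = 0) (h0' : g' 0 = 0) :
    m / 2 ≤ g 1 ∧ g 1 ≤ g' 1 := by
  have mono : ∀ {f f' : ℝ → ℝ}, (∀ t, HasDerivAt f (f' t) t) →
      (∀ t ∈ Set.Icc (0 : ℝ) 1, 0 ≤ f' t) → MonotoneOn f (Set.Icc 0 1) := by
    intro f f' hf hf'
    apply monotoneOn_of_deriv_nonneg (convex_Icc 0 1)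
    · exact fun t _ => (hf t).continuousAt.continuousWithinAt
    · exact fun t _ => (hf t).differentiableAt.differentiableWithinAt
    · intro t ht
      rw [(hf t).deriv]
      exact hf' t (interior_subset ht)
  have z : (0 : ℝ) ∈ Set.Icc (0 : ℝ) 1 := ⟨le_rfl, zero_le_one⟩
  have o : (1 : ℝ) ∈ Set.Icc (0 : ℝ) 1 := ⟨zero_le_one, le_rfl⟩
  have hg't : ∀ t ∈ Set.Icc (0 : ℝ) 1, m * t ≤ g' t := by
    intro t ht
    have := mono (f := fun t => g' t - m * t) (f' := fun t => g'' t - m)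
      (fun t => ((h2 t).sub ((hasDerivAt_id t).const_mul m)).congr_deriv (by simp))
      (fun t ht => by linarith [hg t ht]) z ht ht.1
    simp only [h0', mul_zero, sub_zero] at this
    linarith
  constructor
  · have := mono (f := fun t => g t - m / 2 * (t * t)) (f' := fun t => g' t - m * t)
      (fun t => by
        refine ((h1 t).sub (((hasDerivAt_id t).mul (hasDerivAt_id t)).const_mul (m / 2))).congr_deriv ?_
        simp; ring)
      (fun t ht => by linarith [hg't t ht]) z o zero_le_one
    simp only [h0] at this
    linarith
  · have := mono (f := fun t => t * g' t - g t) (f' := fun t => t * g'' t)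
      (fun t => by
        refine (((hasDerivAt_id t).mul (h2 t)).sub (h1 t)).congr_deriv ?_
        simp)
      (fun t ht => mul_nonneg ht.1 (hm.trans (hg t ht))) z o zero_le_one
    simp only [h0] at this
    linarith

theorem near_well_bounds {V : Evec k → ℝ} (hV : ContDiff ℝ (⊤ : ℕ∞) V) (hV0 : ∀ y, 0 ≤ V y)
    {σ : Evec k} (hσ : V σ = 0) {r m : ℝ} (hm : 0 < m)
    (hh : ∀ y ∈ ball σ r, ∀ w : Evec k, m * ‖w‖ ^ 2 ≤ iteratedFDeriv ℝ 2 V y ![w, w])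
    {y : Evec k} (hy : y ∈ ball σ r) :
    m / 2 * ‖y - σ‖ ^ 2 ≤ V y ∧ V y ≤ ⟪gradient V y, y - σ⟫ := by
  set w := y - σ with hw
  have hdV : Differentiable ℝ V := diff_of_contDiff hV
  have hddV : Differentiable ℝ (fderiv ℝ V) :=
    diff_of_contDiff (hV.fderiv_right (m := ((⊤ : ℕ∞) : WithTop ℕ∞)) (by simp))
  have hl : ∀ t : ℝ, HasDerivAt (fun s : ℝ => σ + s • w) w t := fun t => by
    simpa using ((hasDerivAt_id t).smul_const w).const_add σ
  have h1 : ∀ t : ℝ, HasDerivAt (fun s : ℝ => V (σ + s • w)) (fderiv ℝ V (σ + t • w) w) t :=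
    fun t => (hdV (σ + t • w)).hasFDerivAt.comp_hasDerivAt t (hl t)
  have h2 : ∀ t : ℝ, HasDerivAt (fun s : ℝ => fderiv ℝ V (σ + s • w) w)
      (fderiv ℝ (fderiv ℝ V) (σ + t • w) w w) t := fun t => by
    have h : HasDerivAt (fun s : ℝ => fderiv ℝ V (σ + s • w))
        (fderiv ℝ (fderiv ℝ V) (σ + t • w) w) t :=
      (hddV (σ + t • w)).hasFDerivAt.comp_hasDerivAt t (hl t)
    exact (h.clm_apply (hasDerivAt_const t w)).congr_deriv (by rw [map_zero, add_zero])
  have hcrit : fderiv ℝ V σ = 0 := by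
    have : IsLocalMin V σ := Eventually.of_forall fun z => by rw [hσ]; exact hV0 z
    exact this.fderiv_eq_zero
  have := one_dim_convexity (m := m * ‖w‖ ^ 2) (by positivity) h1 h2 (by
    intro t ht
    have hmem : σ + t • w ∈ ball σ r := by
      rw [mem_ball, dist_eq_norm] at hy ⊢
      rw [add_sub_cancel_left, norm_smul, Real.norm_eq_abs, abs_of_nonneg ht.1]
      refine lt_of_le_of_lt ?_ hy
      exact mul_le_of_le_one_left (norm_nonneg _) ht.2
    have := hh _ hmem w
    rwa [iteratedFDeriv_two_apply] at this) (by simpa using hσ) (by simp [hcrit])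
  simp only [one_smul, hw, add_sub_cancel] at this
  rw [fderiv_apply_eq_inner_gradient hV] at this
  exact ⟨by rw [hw]; linarith [this.1], this.2⟩

/-- Points where the potential is small are close to a well. -/
theorem exists_near_well {V : Evec k → ℝ} (hV : IsMultiWell V) {r : ℝ} (hr : 0 < r) :
    ∃ c > (0 : ℝ), ∀ y, V y < c → ∃ σ, V σ = 0 ∧ ‖y - σ‖ < r := by
  obtain ⟨R, hR⟩ := hV.coercive 1
  set K : Set (Evec k) := closedBall 0 R \ ⋃ σ ∈ {y : Evec k | V y = 0}, ball σ r with hK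
  have hKc : IsCompact K :=
    (isCompact_closedBall 0 R).diff (isOpen_biUnion fun _ _ => isOpen_ball)
  have hmem : ∀ y, ‖y‖ ≤ R → (¬ ∃ σ, V σ = 0 ∧ ‖y - σ‖ < r) → y ∈ K := by
    intro y hy hn
    refine ⟨by simpa using hy, ?_⟩
    simp only [Set.mem_iUnion, not_exists]
    intro σ hσ hyσ
    exact hn ⟨σ, hσ, by simpa [dist_eq_norm] using hyσ⟩
  rcases K.eq_empty_or_nonempty with hE | hne
  · refine ⟨1, one_pos, fun y hy => ?_⟩
    by_contra hn
    have : ‖y‖ ≤ R := by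
      by_contra! h
      exact absurd (hR y h.le) (not_le.2 hy)
    have := hmem y this hn
    rw [hE] at this
    exact this
  · obtain ⟨z, hz, hmin⟩ := hKc.exists_isMinOn hne hV.smooth.continuous.continuousOn
    have hzpos : 0 < V z := by
      refine lt_of_le_of_ne (hV.nonneg z) fun h => hz.2 ?_
      simp only [Set.mem_iUnion]
      exact ⟨z, h.symm, mem_ball_self hr⟩
    refine ⟨min 1 (V z), lt_min one_pos hzpos, fun y hy => ?_⟩
    by_contra hn
    have : ‖y‖ ≤ R := by
      by_contra! h
      exact absurd (hR y h.le) (not_le.2 (hy.trans_le (min_le_left _ _)))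
    exact absurd (hmin (hmem y this hn)) (not_le.2 (hy.trans_le (min_le_right _ _)))

/-- A vector field which is `y ↦ y - σ` near each well `σ`, and whose defect elsewhere is controlled
by the potential. -/
theorem exists_test_field {V : Evec k → ℝ} (hV : IsMultiWell V) {μ₀ : ℝ} (hμ₀ : 0 < μ₀)
    (hdisj : ∀ σ σ' : Evec k, V σ = 0 → V σ' = 0 → σ ≠ σ' →
      Disjoint (ball σ (2 * μ₀)) (ball σ' (2 * μ₀)))
    (hhess : ∀ σ : Evec k, V σ = 0 → ∃ lm lp : ℝ, 0 < lm ∧ lm ≤ lp ∧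
      ∀ y ∈ ball σ (2 * μ₀), ∀ w : Evec k,
        lm / 2 * ‖w‖ ^ 2 ≤ iteratedFDeriv ℝ 2 V y ![w, w] ∧
        iteratedFDeriv ℝ 2 V y ![w, w] ≤ 2 * lp * ‖w‖ ^ 2) (M : ℝ) :
    ∃ T : Evec k → Evec k, ContDiff ℝ (⊤ : ℕ∞) T ∧ ∃ c₀ > (0 : ℝ), ∃ C ≥ (1 : ℝ),
      (∀ y, V y < c₀ → ∃ σ, V σ = 0 ∧ ‖y - σ‖ < μ₀ / 2) ∧
      (∀ y, V y < c₀ → ‖T y‖ ^ 2 ≤ C * V y ∧ V y ≤ ⟪gradient V y, T y⟫ ∧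
        ∀ w, ⟪fderiv ℝ T y w, w⟫ = ‖w‖ ^ 2) ∧
      (∀ y, ‖y‖ ≤ M → ‖T y‖ ^ 2 ≤ C * V y ∧ - (C * V y) ≤ ⟪gradient V y, T y⟫ ∧
        ∀ w, ‖w‖ ^ 2 - C * V y * ‖w‖ ^ 2 ≤ ⟪fderiv ℝ T y w, w⟫) := by
  classical
  obtain ⟨c₀, hc₀, hnear⟩ := exists_near_well hV (half_pos hμ₀)
  have hhess' : ∀ σ : Evec k, ∃ lm : ℝ, 0 < lm ∧ (V σ = 0 → ∀ y ∈ ball σ (2 * μ₀), ∀ w : Evec k,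
      lm / 2 * ‖w‖ ^ 2 ≤ iteratedFDeriv ℝ 2 V y ![w, w]) := by
    intro σ
    by_cases h : V σ = 0
    · obtain ⟨lm, lp, h1, -, h3⟩ := hhess σ h
      exact ⟨lm, h1, fun _ y hy w => (h3 y hy w).1⟩
    · exact ⟨1, one_pos, fun h' => absurd h' h⟩
  choose lm hlm hlmb using hhess'
  set S := hV.finite_zeros.toFinset with hS
  have hSmem : ∀ σ, σ ∈ S ↔ V σ = 0 := fun σ => by simp [hS]
  let θ : ∀ σ : Evec k, ContDiffBump σ := fun σ => ⟨μ₀ / 2, μ₀, half_pos hμ₀, half_lt_self hμ₀⟩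
  set T : Evec k → Evec k := fun y => ∑ σ ∈ S, θ σ y • (y - σ) with hTdef
  have hT : ContDiff ℝ (⊤ : ℕ∞) T :=
    ContDiff.sum fun σ _ => (θ σ).contDiff.smul (contDiff_id.sub contDiff_const)
  have hTnear : ∀ σ, V σ = 0 → ∀ y ∈ ball σ (μ₀ / 2), T y = y - σ := by
    intro σ hσ y hy
    rw [mem_ball] at hy
    simp only [hTdef]
    rw [Finset.sum_eq_single σ]
    · rw [(θ σ).one_of_mem_closedBall (mem_closedBall.2 hy.le), one_smul]
    · intro σ' hσ' hne
      have hd := hdisj σ σ' hσ ((hSmem σ').1 hσ') hne.symm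
      have h1 : y ∈ ball σ (2 * μ₀) := mem_ball.2 (by linarith)
      have h2 : y ∉ ball σ' (2 * μ₀) := Set.disjoint_left.1 hd h1
      have h3 : μ₀ ≤ dist y σ' := by
        rw [mem_ball, not_lt] at h2
        linarith
      rw [(θ σ').zero_of_le_dist h3, zero_smul]
    · intro h
      exact absurd ((hSmem σ).2 hσ) h
  have hdTnear : ∀ σ, V σ = 0 → ∀ y ∈ ball σ (μ₀ / 2), fderiv ℝ T y = ContinuousLinearMap.id ℝ _ := by
    intro σ hσ y hy
    have : T =ᶠ[𝓝 y] fun z => z - σ := by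
      filter_upwards [isOpen_ball.mem_nhds hy] with z hz using hTnear σ hσ z hz
    rw [this.fderiv_eq, fderiv_sub_const]
    exact fderiv_id
  set C₁ := ∑ σ ∈ S, 4 / lm σ with hC₁
  have hgood : ∀ y, V y < c₀ → ‖T y‖ ^ 2 ≤ C₁ * V y ∧ V y ≤ ⟪gradient V y, T y⟫ ∧
        ∀ w, ⟪fderiv ℝ T y w, w⟫ = ‖w‖ ^ 2 := by
    intro y hy
    obtain ⟨σ, hσ, hyσ⟩ := hnear y hy
    have hb : y ∈ ball σ (μ₀ / 2) := by rwa [mem_ball, dist_eq_norm]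
    have hb' : y ∈ ball σ (2 * μ₀) := ball_subset_ball (by linarith) hb
    obtain ⟨h1, h2⟩ := near_well_bounds hV.smooth hV.nonneg hσ (half_pos (hlm σ))
      (hlmb σ hσ) hb'
    rw [hTnear σ hσ y hb, hdTnear σ hσ y hb]
    refine ⟨?_, h2, fun w => by simp⟩
    have h3 : 4 / lm σ ≤ C₁ := Finset.single_le_sum (f := fun σ => 4 / lm σ)
      (fun σ _ => (div_pos four_pos (hlm σ)).le) ((hSmem σ).2 hσ)
    have h4 : ‖y - σ‖ ^ 2 ≤ 4 / lm σ * V y := by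
      rw [div_mul_eq_mul_div, le_div_iff₀ (hlm σ)]
      linarith
    exact h4.trans (mul_le_mul_of_nonneg_right h3 (hV.nonneg y))
  have hgc := continuous_gradient hV.smooth
  have hdTc : Continuous (fderiv ℝ T) := hT.continuous_fderiv (by simp)
  have hTc := hT.continuous
  obtain ⟨B, hB⟩ := (isCompact_closedBall (0 : Evec k) M).exists_bound_of_continuousOn
    (f := fun y => ‖T y‖ ^ 2 + |⟪gradient V y, T y⟫| + ‖fderiv ℝ T y‖)
    (by
      apply Continuous.continuousOn
      exact ((hTc.norm.pow 2).add (hgc.inner hTc).abs).add hdTc.norm)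
  set C := max 1 (max C₁ ((1 + |B|) / c₀)) with hC
  have hC1 : 1 ≤ C := le_max_left _ _
  have hC2 : C₁ ≤ C := (le_max_left _ _).trans (le_max_right _ _)
  have hC3 : (1 + |B|) / c₀ ≤ C := (le_max_right _ _).trans (le_max_right _ _)
  refine ⟨T, hT, c₀, hc₀, C, hC1, hnear, fun y hy => ?_, fun y hy => ?_⟩
  · obtain ⟨h1, h2, h3⟩ := hgood y hy
    exact ⟨h1.trans (mul_le_mul_of_nonneg_right hC2 (hV.nonneg y)), h2, h3⟩
  · have hVy := hV.nonneg y
    by_cases h : V y < c₀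
    · obtain ⟨h1, h2, h3⟩ := hgood y h
      refine ⟨h1.trans (mul_le_mul_of_nonneg_right hC2 hVy), ?_, fun w => ?_⟩
      · have : 0 ≤ C * V y := by positivity
        linarith
      · rw [h3]
        have : 0 ≤ C * V y * ‖w‖ ^ 2 := by positivity
        linarith
    · push Not at h
      have hb := hB y (by simpa using hy)
      rw [Real.norm_eq_abs, abs_of_nonneg (by positivity)] at hb
      have hb' := hb.trans (le_abs_self B)
      have hCV : 1 + |B| ≤ C * V y := by
        calc 1 + |B| = (1 + |B|) / c₀ * c₀ := by field_simp
          _ ≤ C * V y := by gcongr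
      have n1 : 0 ≤ ‖T y‖ ^ 2 := by positivity
      have n2 := abs_nonneg ⟪gradient V y, T y⟫
      have n3 := norm_nonneg (fderiv ℝ T y)
      refine ⟨by linarith, ?_, fun w => ?_⟩
      · have := neg_abs_le ⟪gradient V y, T y⟫
        linarith
      · have h1 : |⟪fderiv ℝ T y w, w⟫| ≤ |B| * ‖w‖ ^ 2 := by
          calc |⟪fderiv ℝ T y w, w⟫| ≤ ‖fderiv ℝ T y w‖ * ‖w‖ := abs_real_inner_le_norm _ _
            _ ≤ (‖fderiv ℝ T y‖ * ‖w‖) * ‖w‖ := by gcongr; exact (fderiv ℝ T y).le_opNorm w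
            _ = ‖fderiv ℝ T y‖ * ‖w‖ ^ 2 := by ring
            _ ≤ _ := by gcongr; linarith
        have h2 : (1 + |B|) * ‖w‖ ^ 2 ≤ C * V y * ‖w‖ ^ 2 := by gcongr
        linarith [neg_abs_le ⟪fderiv ℝ T y w, w⟫]

end Potential

section Cutoff

theorem exists_bound_deriv_smoothTransition :
    ∃ C > (0 : ℝ), ∀ t, |deriv Real.smoothTransition t| ≤ C := by
  have hc : Continuous (deriv Real.smoothTransition) :=
    (Real.smoothTransition.contDiff (n := 1)).continuous_deriv le_rfl
  obtain ⟨C, hC⟩ := isCompact_Icc.exists_bound_of_continuousOn (s := Set.Icc (0 : ℝ) 1)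
    hc.continuousOn
  refine ⟨max C 1, lt_max_of_lt_right one_pos, fun t => ?_⟩
  rcases le_or_gt t 0 with h | h
  · have : IsLocalMin Real.smoothTransition t := Eventually.of_forall fun s => by
      rw [Real.smoothTransition.zero_of_nonpos h]; exact Real.smoothTransition.nonneg s
    simp [this.deriv_eq_zero]
  rcases le_or_gt 1 t with h' | h'
  · have : IsLocalMax Real.smoothTransition t := Eventually.of_forall fun s => by
      rw [Real.smoothTransition.one_of_one_le h']; exact Real.smoothTransition.le_one s
    simp [this.deriv_eq_zero]
  · exact (hC t ⟨h.le, h'.le⟩).trans (le_max_left _ _)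

theorem abs_coord_le_norm (x : E2) (i : Fin 2) : |x i| ≤ ‖x‖ := by
  simpa using PiLp.norm_apply_le x i

/-- Radial cutoff functions with the expected gradient bound. -/
theorem exists_cutoff : ∃ C > (0 : ℝ), ∀ a b : ℝ, 0 < a → a < b →
    ∃ ψ : E2 → ℝ, ContDiff ℝ (⊤ : ℕ∞) ψ ∧ (∀ x, 0 ≤ ψ x) ∧ (∀ x, ψ x ≤ 1) ∧
      (∀ x, ‖x‖ ≤ a → ψ x = 1) ∧ (∀ x, b ≤ ‖x‖ → ψ x = 0) ∧
      (∀ i x, |pd ψ i x| ≤ C / (b - a)) ∧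
      (∀ i x, ‖x‖ < a ∨ b ≤ ‖x‖ → pd ψ i x = 0) := by
  obtain ⟨C, hC, hCb⟩ := exists_bound_deriv_smoothTransition
  refine ⟨2 * C, by positivity, fun a b ha hab => ?_⟩
  have hb : 0 < b := ha.trans hab
  have hd : 0 < b ^ 2 - a ^ 2 := by nlinarith
  set φ : E2 → ℝ := fun x => (b ^ 2 - a ^ 2)⁻¹ * (b ^ 2 - ‖x‖ ^ 2) with hφ
  have hφs : ContDiff ℝ (⊤ : ℕ∞) φ :=
    contDiff_const.mul (contDiff_const.sub (contDiff_norm_sq ℝ))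
  set ψ : E2 → ℝ := fun x => Real.smoothTransition (φ x) with hψ
  have hφ1 : ∀ x : E2, ‖x‖ ≤ a → 1 ≤ φ x := by
    intro x hx
    have : ‖x‖ ^ 2 ≤ a ^ 2 := by gcongr
    rw [hφ]
    simp only
    rw [inv_mul_eq_div, le_div_iff₀ hd]
    linarith
  have hφ0 : ∀ x : E2, b ≤ ‖x‖ → φ x ≤ 0 := by
    intro x hx
    have : b ^ 2 ≤ ‖x‖ ^ 2 := by gcongr
    exact mul_nonpos_of_nonneg_of_nonpos (inv_nonneg.2 hd.le) (by linarith)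
  have h1 : ∀ x, ‖x‖ ≤ a → ψ x = 1 := fun x hx =>
    Real.smoothTransition.one_of_one_le (hφ1 x hx)
  have h0 : ∀ x, b ≤ ‖x‖ → ψ x = 0 := fun x hx =>
    Real.smoothTransition.zero_of_nonpos (hφ0 x hx)
  have hz : ∀ i x, ‖x‖ < a ∨ b ≤ ‖x‖ → pd ψ i x = 0 := by
    rintro i x (hx | hx)
    · have : IsLocalMax ψ x := Eventually.of_forall fun y => by
        rw [h1 x hx.le]; exact Real.smoothTransition.le_one _
      rw [pd, this.fderiv_eq_zero]; simp
    · have : IsLocalMin ψ x := Eventually.of_forall fun y => by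
        rw [h0 x hx]; exact Real.smoothTransition.nonneg _
      rw [pd, this.fderiv_eq_zero]; simp
  refine ⟨ψ, Real.smoothTransition.contDiff.comp hφs, fun x => Real.smoothTransition.nonneg _,
    fun x => Real.smoothTransition.le_one _, h1, h0, fun i x => ?_, hz⟩
  have hba : 0 < b - a := sub_pos.2 hab
  rcases le_or_gt b ‖x‖ with hx | hx
  · rw [hz i x (Or.inr hx), abs_zero]; positivity
  have hpd : pd ψ i x = deriv Real.smoothTransition (φ x) * ((b ^ 2 - a ^ 2)⁻¹ * (- (2 * x i))) := by
    have hS : HasDerivAt Real.smoothTransition (deriv Real.smoothTransition (φ x)) (φ x) :=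
      ((Real.smoothTransition.contDiff (n := 1)).differentiable one_ne_zero _).hasDerivAt
    have := hS.comp_hasFDerivAt x (diff_of_contDiff hφs x).hasFDerivAt
    have h2 : pd φ i x = (b ^ 2 - a ^ 2)⁻¹ * (- (2 * x i)) := by
      have hn : HasFDerivAt (fun y : E2 => ‖y‖ ^ 2) (2 • (innerSL ℝ x)) x :=
        (hasStrictFDerivAt_norm_sq x).hasFDerivAt
      rw [pd, ((hn.const_sub (b ^ 2)).const_mul ((b ^ 2 - a ^ 2)⁻¹)).fderiv]
      simp [b2, EuclideanSpace.inner_single_right]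
    rw [← h2]
    change fderiv ℝ (Real.smoothTransition ∘ φ) x (b2 i) = _
    rw [this.fderiv]
    rfl
  rw [hpd, abs_mul, abs_mul, abs_of_pos (inv_pos.2 hd), abs_neg, abs_mul, abs_two]
  have hxi : |x i| ≤ b := (abs_coord_le_norm x i).trans hx.le
  calc |deriv Real.smoothTransition (φ x)| * ((b ^ 2 - a ^ 2)⁻¹ * (2 * |x i|))
      ≤ C * ((b ^ 2 - a ^ 2)⁻¹ * (2 * b)) := by
        gcongr
        exact hCb _
    _ = 2 * C / (b - a) * (b / (b + a)) := by
        have : b ^ 2 - a ^ 2 = (b - a) * (b + a) := by ring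
        rw [this]
        field_simp
    _ ≤ 2 * C / (b - a) * 1 := by
        gcongr
        rw [div_le_one (by positivity)]
        linarith
    _ = 2 * C / (b - a) := mul_one _

theorem hasCompactSupport_of_zero_outside {F : Type*} [Zero F] {ψ : E2 → F} {b : ℝ}
    (h : ∀ x, b ≤ ‖x‖ → ψ x = 0) : HasCompactSupport ψ := by
  refine HasCompactSupport.intro (isCompact_closedBall (0 : E2) b) fun x hx => h x ?_
  simp only [mem_closedBall, dist_zero_right, not_le] at hx
  exact hx.le

end Cutoff

section EnergyInequalities

variable {k : ℕ}

/-- The energy density at unit scale. -/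
def ed (V : Evec k → ℝ) (v : E2 → Evec k) (x : E2) : ℝ :=
  2⁻¹ * (‖pd v 0 x‖ ^ 2 + ‖pd v 1 x‖ ^ 2) + V (v x)

theorem continuous_ed {V : Evec k → ℝ} (hV : ContDiff ℝ (⊤ : ℕ∞) V) {v : E2 → Evec k}
    (hv : ContDiff ℝ (⊤ : ℕ∞) v) : Continuous (ed V v) := by
  have h0 := (contDiff_pd hv 0).continuous
  have h1 := (contDiff_pd hv 1).continuous
  have h2 := hV.continuous.comp hv.continuous
  exact (continuous_const.mul ((h0.norm.pow 2).add (h1.norm.pow 2))).add h2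

theorem ed_nonneg {V : Evec k → ℝ} (hV0 : ∀ y, 0 ≤ V y) (v : E2 → Evec k) (x : E2) :
    0 ≤ ed V v x := by
  have := hV0 (v x)
  unfold ed
  positivity

theorem Continuous.integrableOn_of_bounded {f : E2 → ℝ} (hf : Continuous f) {S : Set E2} {b : ℝ}
    (hS : ∀ x ∈ S, ‖x‖ ≤ b) : IntegrableOn f S :=
  (hf.continuousOn.integrableOn_compact (isCompact_closedBall (0 : E2) b)).mono_set
    fun x hx => by simpa using hS x hx

theorem integral_test_le {V : Evec k → ℝ} (hV : ContDiff ℝ (⊤ : ℕ∞) V) {v : E2 → Evec k}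
    (hv : ContDiff ℝ (⊤ : ℕ∞) v) {T : Evec k → Evec k} (hT : ContDiff ℝ (⊤ : ℕ∞) T)
    {ψ : E2 → ℝ} (hψ : ContDiff ℝ (⊤ : ℕ∞) ψ) (hψc : HasCompactSupport ψ)
    (hpde : ∀ x, ψ x ≠ 0 → ∑ i, pd (pd v i) i x = gradient V (v x))
    {S : Set E2} (hS : MeasurableSet S) {b : ℝ} (hSb : ∀ x ∈ S, ‖x‖ ≤ b) {A C : ℝ} (hC : 1 ≤ C)
    (hA : ∀ i x, |pd ψ i x| ≤ A) (hA0 : ∀ i x, x ∉ S → pd ψ i x = 0)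
    (hTS : ∀ x ∈ S, ‖T (v x)‖ ^ 2 ≤ C * V (v x)) :
    ∫ x, ψ x * (⟪fderiv ℝ T (v x) (pd v 0 x), pd v 0 x⟫ + ⟪fderiv ℝ T (v x) (pd v 1 x), pd v 1 x⟫
        + ⟪gradient V (v x), T (v x)⟫) ≤ A * C * ∫ x in S, ed V v x := by
  rw [integral_test_eq hV hv hT hψ hψc hpde, ← integral_neg, ← integral_const_mul,
    ← integral_indicator hS]
  have hTv : Continuous fun x => T (v x) := hT.continuous.comp hv.continuous
  have hA' : 0 ≤ A := (abs_nonneg _).trans (hA 0 0)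
  have hcs : ∀ i, HasCompactSupport (pd ψ i) := fun i => hψc.fderiv_apply ℝ (b2 i)
  have hint : ∀ i, Integrable fun x => pd ψ i x * ⟪pd v i x, T (v x)⟫ := fun i =>
    (((contDiff_pd hψ i).continuous.mul
      ((contDiff_pd hv i).continuous.inner hTv))).integrable_of_hasCompactSupport
      ((hcs i).mul_right)
  refine integral_mono ((hint 0).add (hint 1)).neg ?_ fun x => ?_
  · rw [integrable_indicator_iff hS]
    exact ((continuous_ed hV hv).integrableOn_of_bounded hSb).const_mul _
  · by_cases hx : x ∈ S
    · rw [Set.indicator_of_mem hx]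
      have key : ∀ i, -(pd ψ i x * ⟪pd v i x, T (v x)⟫)
          ≤ A * (2⁻¹ * ‖pd v i x‖ ^ 2 + 2⁻¹ * ‖T (v x)‖ ^ 2) := by
        intro i
        refine (neg_le_abs _).trans ?_
        rw [abs_mul]
        refine mul_le_mul (hA i x) ?_ (abs_nonneg _) hA'
        refine (abs_real_inner_le_norm _ _).trans ?_
        nlinarith [sq_nonneg (‖pd v i x‖ - ‖T (v x)‖)]
      have k0 := key 0
      have k1 := key 1
      have h1 : ‖T (v x)‖ ^ 2 + 2⁻¹ * (‖pd v 0 x‖ ^ 2 + ‖pd v 1 x‖ ^ 2) ≤ C * ed V v x := by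
        have := hTS x hx
        have h3 : 0 ≤ 2⁻¹ * (‖pd v 0 x‖ ^ 2 + ‖pd v 1 x‖ ^ 2) := by positivity
        unfold ed
        nlinarith
      have h2 := mul_le_mul_of_nonneg_left h1 hA'
      simp only
      linarith
    · rw [Set.indicator_of_notMem hx]
      simp [hA0 0 x hx, hA0 1 x hx]

/-- Caccioppoli-type inequality in a region where the potential is small. -/
theorem integral_cutoff_ed_le {V : Evec k → ℝ} (hV : ContDiff ℝ (⊤ : ℕ∞) V) {v : E2 → Evec k}
    (hv : ContDiff ℝ (⊤ : ℕ∞) v) {T : Evec k → Evec k} (hT : ContDiff ℝ (⊤ : ℕ∞) T)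
    {ψ : E2 → ℝ} (hψ : ContDiff ℝ (⊤ : ℕ∞) ψ) (hψc : HasCompactSupport ψ) (hψ0 : ∀ x, 0 ≤ ψ x)
    (hpde : ∀ x, ψ x ≠ 0 → ∑ i, pd (pd v i) i x = gradient V (v x))
    {S : Set E2} (hS : MeasurableSet S) {b : ℝ} (hSb : ∀ x ∈ S, ‖x‖ ≤ b)
    {A C B D : ℝ} (hC : 1 ≤ C)
    (hA : ∀ i x, |pd ψ i x| ≤ A) (hA0 : ∀ i x, x ∉ S → pd ψ i x = 0)
    (hTS : ∀ x ∈ S, ‖T (v x)‖ ^ 2 ≤ C * V (v x))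
    (hB : ∀ x, ψ x ≠ 0 → V (v x) - B * V (v x) ≤ ⟪gradient V (v x), T (v x)⟫)
    (hD : ∀ x, ψ x ≠ 0 → ∀ i, 2⁻¹ * ‖pd v i x‖ ^ 2 - D * V (v x) ≤
      ⟪fderiv ℝ T (v x) (pd v i x), pd v i x⟫) :
    ∫ x, ψ x * ed V v x ≤
      (B + 2 * D) * (∫ x, ψ x * V (v x)) + A * C * ∫ x in S, ed V v x := by
  refine le_trans ?_ (add_le_add_right
    (integral_test_le hV hv hT hψ hψc hpde hS hSb hC hA hA0 hTS) _)
  have hTv : Continuous fun x => T (v x) := hT.continuous.comp hv.continuous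
  have hVv : Continuous fun x => V (v x) := hV.continuous.comp hv.continuous
  have hgV : Continuous fun x => gradient V (v x) := (continuous_gradient hV).comp hv.continuous
  have hp : ∀ i, Continuous (pd v i) := fun i => (contDiff_pd hv i).continuous
  have hDT : ∀ i, Continuous fun x => fderiv ℝ T (v x) (pd v i x) := fun i =>
    ((hT.continuous_fderiv (by simp)).comp hv.continuous).clm_apply (hp i)
  have hint : ∀ {f : E2 → ℝ}, Continuous f → Integrable fun x => ψ x * f x := fun hf =>
    (hψ.continuous.mul hf).integrable_of_hasCompactSupport hψc.mul_right
  have i1 := hint (continuous_ed hV hv)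
  have i2 := (hint hVv).const_mul (B + 2 * D)
  have i3 : Integrable fun x => ψ x * (⟪fderiv ℝ T (v x) (pd v 0 x), pd v 0 x⟫ +
      ⟪fderiv ℝ T (v x) (pd v 1 x), pd v 1 x⟫ + ⟪gradient V (v x), T (v x)⟫) :=
    hint ((((hDT 0).inner (hp 0)).add ((hDT 1).inner (hp 1))).add (hgV.inner hTv))
  rw [← integral_const_mul, ← integral_add i2 i3]
  refine integral_mono i1 (i2.add i3) fun x => ?_
  by_cases hx : ψ x = 0
  · simp [hx]
  · have h1 := hB x hx
    have h2 := hD x hx 0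
    have h3 := hD x hx 1
    have : ed V v x ≤ (B + 2 * D) * V (v x) + (⟪fderiv ℝ T (v x) (pd v 0 x), pd v 0 x⟫ +
        ⟪fderiv ℝ T (v x) (pd v 1 x), pd v 1 x⟫ + ⟪gradient V (v x), T (v x)⟫) := by
      unfold ed
      linarith
    have := mul_le_mul_of_nonneg_left this (hψ0 x)
    simp only
    linarith

theorem integral_pohozaev_le {V : Evec k → ℝ} (hV : ContDiff ℝ (⊤ : ℕ∞) V) {v : E2 → Evec k}
    (hV0 : ∀ y, 0 ≤ V y)
    (hv : ContDiff ℝ (⊤ : ℕ∞) v) {ψ : E2 → ℝ} (hψ : ContDiff ℝ (⊤ : ℕ∞) ψ)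
    (hψc : HasCompactSupport ψ)
    (hpde : ∀ x, ψ x ≠ 0 → ∑ i, pd (pd v i) i x = gradient V (v x))
    {S : Set E2} (hS : MeasurableSet S) {b : ℝ} (hSb : ∀ x ∈ S, ‖x‖ ≤ b) {A : ℝ}
    (hA : ∀ i x, |pd ψ i x| ≤ A) (hA0 : ∀ i x, x ∉ S → pd ψ i x = 0) :
    ∫ x, ψ x * V (v x) ≤ 2 * (A * b) * ∫ x in S, ed V v x := by
  have h := integral_pohozaev hV hv hψ hψc hpde
  have h2 : ∫ x, ψ x * (2 * V (v x)) = 2 * ∫ x, ψ x * V (v x) := by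
    rw [← integral_const_mul]
    congr 1
    funext x
    ring
  rw [h2] at h
  suffices hs : - ∫ x, (pd ψ 0 x * (x 0 * (2⁻¹ * (⟪pd v 1 x, pd v 1 x⟫ - ⟪pd v 0 x, pd v 0 x⟫)
            + V (v x)) - x 1 * ⟪pd v 0 x, pd v 1 x⟫)
          + pd ψ 1 x * (x 1 * (2⁻¹ * (⟪pd v 0 x, pd v 0 x⟫ - ⟪pd v 1 x, pd v 1 x⟫) + V (v x))
            - x 0 * ⟪pd v 0 x, pd v 1 x⟫)) ≤ 4 * (A * b) * ∫ x in S, ed V v x by linarith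
  have hA' : 0 ≤ A := (abs_nonneg _).trans (hA 0 0)
  have hVv : Continuous fun x => V (v x) := hV.continuous.comp hv.continuous
  have hp : ∀ i, Continuous (pd v i) := fun i => (contDiff_pd hv i).continuous
  have hco : ∀ i, Continuous fun x : E2 => x i := fun i => (contDiff_coord i).continuous
  have hpp : ∀ i j, Continuous fun x => ⟪pd v i x, pd v j x⟫ := fun i j => (hp i).inner (hp j)
  have hcs : ∀ i, HasCompactSupport (pd ψ i) := fun i => hψc.fderiv_apply ℝ (b2 i)
  have hint : ∀ i, ∀ {f : E2 → ℝ}, Continuous f → Integrable fun x => pd ψ i x * f x :=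
    fun i f hf => ((contDiff_pd hψ i).continuous.mul hf).integrable_of_hasCompactSupport
      (hcs i).mul_right
  have i0 := hint 0 (((hco 0).mul ((continuous_const.mul ((hpp 1 1).sub (hpp 0 0))).add hVv)).sub
    ((hco 1).mul (hpp 0 1)) : Continuous fun x : E2 => x 0 * (2⁻¹ * (⟪pd v 1 x, pd v 1 x⟫
      - ⟪pd v 0 x, pd v 0 x⟫) + V (v x)) - x 1 * ⟪pd v 0 x, pd v 1 x⟫)
  have i1 := hint 1 (((hco 1).mul ((continuous_const.mul ((hpp 0 0).sub (hpp 1 1))).add hVv)).sub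
    ((hco 0).mul (hpp 0 1)) : Continuous fun x : E2 => x 1 * (2⁻¹ * (⟪pd v 0 x, pd v 0 x⟫
      - ⟪pd v 1 x, pd v 1 x⟫) + V (v x)) - x 0 * ⟪pd v 0 x, pd v 1 x⟫)
  rw [← integral_neg, ← integral_const_mul, ← integral_indicator hS]
  refine integral_mono (i0.add i1).neg ?_ fun x => ?_
  · rw [integrable_indicator_iff hS]
    exact ((continuous_ed hV hv).integrableOn_of_bounded hSb).const_mul _
  · by_cases hx : x ∈ S
    · rw [Set.indicator_of_mem hx]
      have hb : 0 ≤ b := (norm_nonneg _).trans (hSb x hx)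
      have hxb : ∀ i, |x i| ≤ b := fun i => (abs_coord_le_norm x i).trans (hSb x hx)
      have he := hV0 (v x)
      have hin : |⟪pd v 0 x, pd v 1 x⟫| ≤ ed V v x := by
        refine (abs_real_inner_le_norm _ _).trans ?_
        unfold ed
        nlinarith [sq_nonneg (‖pd v 0 x‖ - ‖pd v 1 x‖)]
      have hd : |2⁻¹ * (⟪pd v 1 x, pd v 1 x⟫ - ⟪pd v 0 x, pd v 0 x⟫) + V (v x)| ≤ ed V v x := by
        rw [real_inner_self_eq_norm_sq, real_inner_self_eq_norm_sq]
        unfold ed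
        rw [abs_le]
        constructor <;> nlinarith [sq_nonneg ‖pd v 0 x‖, sq_nonneg ‖pd v 1 x‖]
      have hd' : |2⁻¹ * (⟪pd v 0 x, pd v 0 x⟫ - ⟪pd v 1 x, pd v 1 x⟫) + V (v x)| ≤ ed V v x := by
        rw [real_inner_self_eq_norm_sq, real_inner_self_eq_norm_sq]
        unfold ed
        rw [abs_le]
        constructor <;> nlinarith [sq_nonneg ‖pd v 0 x‖, sq_nonneg ‖pd v 1 x‖]
      have key : ∀ {i m n : Fin 2} {s t : ℝ}, |s| ≤ ed V v x → |t| ≤ ed V v x →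
          -(pd ψ i x * (x m * s - x n * t)) ≤ A * (b * ed V v x + b * ed V v x) := by
        intro i m n s t hs ht
        refine (neg_le_abs _).trans ?_
        rw [abs_mul]
        refine mul_le_mul (hA i x) ?_ (abs_nonneg _) hA'
        refine (abs_sub _ _).trans ?_
        rw [abs_mul, abs_mul]
        exact add_le_add (mul_le_mul (hxb m) hs (abs_nonneg _) hb)
          (mul_le_mul (hxb n) ht (abs_nonneg _) hb)
      have k0 := key (i := 0) (m := 0) (n := 1) hd hin
      have k1 := key (i := 1) (m := 1) (n := 0) hd' hin
      simp only
      linarith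
    · rw [Set.indicator_of_notMem hx]
      simp [hA0 0 x hx, hA0 1 x hx]

end EnergyInequalities

section Decay

variable {k : ℕ}

theorem exists_small_increment {f : ℝ → ℝ} (hf : Monotone f) (hf0 : ∀ r, 0 ≤ f r) {L r : ℝ}
    (hL : 1 ≤ L) (hr : 10 * L ≤ r) :
    ∃ s, r / 2 ≤ s ∧ s + 5 * L ≤ r ∧ (f (s + 5 * L) - f s) * r ≤ 20 * L * f r := by
  have hL0 : 0 < L := by linarith
  have hr0 : 0 < r := by linarith
  set N := ⌊r / (10 * L)⌋₊ with hN
  have hN1 : 1 ≤ N := Nat.le_floor (by rw [Nat.cast_one, le_div_iff₀ (by positivity)]; linarith)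
  have hNle : (N : ℝ) * (10 * L) ≤ r := by
    have := Nat.floor_le (a := r / (10 * L)) (by positivity)
    rwa [le_div_iff₀ (by positivity)] at this
  have hNge : r ≤ (N : ℝ) * (20 * L) := by
    have := Nat.lt_floor_add_one (r / (10 * L))
    rw [div_lt_iff₀ (by positivity), ← hN] at this
    have h1 : (1 : ℝ) ≤ N := by exact_mod_cast hN1
    nlinarith
  have hN0 : (0 : ℝ) < N := by exact_mod_cast hN1
  set s : ℕ → ℝ := fun j => r / 2 + 5 * L * j with hs
  have htel : ∑ j ∈ Finset.range N, (f (s (j + 1)) - f (s j)) ≤ ∑ j ∈ Finset.range N, f r / N := by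
    rw [Finset.sum_range_sub (fun j => f (s j)), Finset.sum_const, Finset.card_range, nsmul_eq_mul,
      mul_div_cancel₀ _ hN0.ne']
    have : f (s N) ≤ f r := hf (by simp only [hs]; linarith)
    linarith [hf0 (s 0)]
  obtain ⟨j, hj, hle⟩ := Finset.exists_le_of_sum_le
    (Finset.nonempty_range_iff.2 (by omega)) htel
  have hjN : (j : ℝ) + 1 ≤ N := by exact_mod_cast Finset.mem_range.1 hj
  have hs1 : s (j + 1) = s j + 5 * L := by simp only [hs]; push_cast; ring
  refine ⟨s j, ?_, ?_, ?_⟩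
  · simp only [hs]
    have : 0 ≤ 5 * L * (j : ℝ) := by positivity
    linarith
  · rw [← hs1]
    simp only [hs]
    push_cast
    nlinarith
  · rw [← hs1]
    have h0 : 0 ≤ f (s (j + 1)) - f (s j) := sub_nonneg.2 (hf (by rw [hs1]; linarith))
    rw [le_div_iff₀ hN0] at hle
    nlinarith

theorem setIntegral_ball_mono {f : E2 → ℝ} (hf : Continuous f) (hf0 : ∀ x, 0 ≤ f x) :
    Monotone fun r : ℝ => ∫ x in ball (0 : E2) r, f x := by
  intro r s hrs
  refine setIntegral_mono_set (hf.integrableOn_of_bounded (b := s) fun x hx => ?_)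
    (Eventually.of_forall hf0) (ball_subset_ball hrs).eventuallyLE
  exact (by simpa using hx : ‖x‖ < s).le

theorem setIntegral_le_integral_mul {f ψ : E2 → ℝ} (hf : Continuous f) (hf0 : ∀ x, 0 ≤ f x)
    (hψ : Continuous ψ) (hψc : HasCompactSupport ψ) (hψ0 : ∀ x, 0 ≤ ψ x) {S : Set E2}
    (hS : MeasurableSet S) {b : ℝ} (hSb : ∀ x ∈ S, ‖x‖ ≤ b) (h1 : ∀ x ∈ S, ψ x = 1) :
    ∫ x in S, f x ≤ ∫ x, ψ x * f x := by
  rw [← integral_indicator hS]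
  refine integral_mono ((integrable_indicator_iff hS).2 (hf.integrableOn_of_bounded hSb))
    ((hψ.mul hf).integrable_of_hasCompactSupport hψc.mul_right) fun x => ?_
  by_cases hx : x ∈ S
  · rw [Set.indicator_of_mem hx]
    simp [h1 x hx]
  · rw [Set.indicator_of_notMem hx]
    exact mul_nonneg (hψ0 x) (hf0 x)

theorem decay_arith {B Cs C L r b m a F Fr I : ℝ} (hB : 0 ≤ B) (hCs : 0 ≤ Cs) (hC : 0 ≤ C)
    (hL : 0 < L) (hr : 1 ≤ r) (hm : 0 ≤ m) (hFr : 0 ≤ Fr) (hb : b ≤ r)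
    (h1 : F ≤ B * I + Cs / L * C * m) (h2 : I ≤ 2 * (Cs / L * b) * m)
    (h3 : m ≤ 2 * Cs / L * C * a) (h4 : a * r ≤ 20 * L * Fr)
    (hLQ : 2 * ((B * (2 * Cs) + Cs * C) * (2 * Cs * C) * 20) ≤ L) : F ≤ Fr / 2 := by
  have h2' : I ≤ 2 * (Cs / L * r) * m := h2.trans (by gcongr)
  have e1 : Cs / L * C * m ≤ Cs / L * C * m * r := le_mul_of_one_le_right (by positivity) hr
  have e2 : F ≤ (B * (2 * Cs) + Cs * C) / L * m * r := by
    have : B * I ≤ B * (2 * (Cs / L * r) * m) := mul_le_mul_of_nonneg_left h2' hB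
    refine (h1.trans (add_le_add this e1)).trans (le_of_eq ?_)
    field_simp
  have e3 : m * r ≤ 2 * Cs / L * C * (20 * L * Fr) := by
    have a1 : m * r ≤ 2 * Cs / L * C * a * r := by gcongr
    have a2 : 2 * Cs / L * C * (a * r) ≤ 2 * Cs / L * C * (20 * L * Fr) := by gcongr
    linarith
  have e4 : (B * (2 * Cs) + Cs * C) / L * (m * r) ≤
      (B * (2 * Cs) + Cs * C) / L * (2 * Cs / L * C * (20 * L * Fr)) := by gcongr
  have e5 : (B * (2 * Cs) + Cs * C) / L * (2 * Cs / L * C * (20 * L * Fr)) =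
      ((B * (2 * Cs) + Cs * C) * (2 * Cs * C) * 20) / L * Fr := by
    field_simp
  have e6 : ((B * (2 * Cs) + Cs * C) * (2 * Cs * C) * 20) / L ≤ 1 / 2 := by
    rw [div_le_div_iff₀ hL two_pos]
    linarith
  have e7 := mul_le_mul_of_nonneg_right e6 hFr
  linarith

set_option maxHeartbeats 800000 in
/-- If the energy on a disk of large radius is small compared to the radius, then a fixed fraction
of it is lost on the disk of half radius. -/
theorem energy_decay {V : Evec k → ℝ} (hV : ContDiff ℝ (⊤ : ℕ∞) V) (hV0 : ∀ y, 0 ≤ V y)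
    {T : Evec k → Evec k} (hT : ContDiff ℝ (⊤ : ℕ∞) T) {c₀ C M K c₁ ρ : ℝ} (hC : 1 ≤ C)
    (hρ1 : ρ ≤ 1)
    (hT1 : ∀ y, V y < c₀ → ‖T y‖ ^ 2 ≤ C * V y ∧ V y ≤ ⟪gradient V y, T y⟫ ∧
        ∀ w, ⟪fderiv ℝ T y w, w⟫ = ‖w‖ ^ 2)
    (hT2 : ∀ y, ‖y‖ ≤ M → ‖T y‖ ^ 2 ≤ C * V y ∧ - (C * V y) ≤ ⟪gradient V y, T y⟫ ∧
        ∀ w, ‖w‖ ^ 2 - C * V y * ‖w‖ ^ 2 ≤ ⟪fderiv ℝ T y w, w⟫) :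
    ∃ L ≥ (1 : ℝ), ∀ v : E2 → Evec k, ContDiff ℝ (⊤ : ℕ∞) v → ∀ R : ℝ,
      (∀ x ∈ ball (0 : E2) R, ∑ i, pd (pd v i) i x = gradient V (v x)) →
      (∀ x ∈ ball (0 : E2) R, ‖v x‖ ≤ M) →
      (∀ x ∈ ball (0 : E2) R, ∀ i, ‖pd v i x‖ ≤ K) →
      (∀ z ∈ ball (0 : E2) R, c₀ ≤ V (v z) → c₁ ≤ ∫ x in ball z ρ, ed V v x) →
      ∀ r, 10 * L ≤ r → r ≤ R → 20 * L * (∫ x in ball (0 : E2) r, ed V v x) < c₁ * r →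
        ∫ x in ball (0 : E2) (r / 2), ed V v x ≤ (∫ x in ball (0 : E2) r, ed V v x) / 2 := by
  obtain ⟨Cs, hCs, hcut⟩ := exists_cutoff
  set B := C + 1 + 2 * (C * K ^ 2) with hB
  have hB0 : 0 ≤ B := by positivity
  set Q := (B * (2 * Cs) + Cs * C) * (2 * Cs * C) * 20 with hQ
  have hQ0 : 0 ≤ Q := by positivity
  refine ⟨2 * Q + 1, by linarith, ?_⟩
  set L := 2 * Q + 1 with hL
  have hL1 : 1 ≤ L := by linarith
  have hL0 : 0 < L := by linarith
  intro v hv R hpde hM hK hconc r hr hrR hsmall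
  have hr0 : 0 < r := by linarith
  have hec := continuous_ed hV hv
  have he0 := ed_nonneg hV0 v
  set f : ℝ → ℝ := fun r => ∫ x in ball (0 : E2) r, ed V v x with hf
  have hfm : Monotone f := setIntegral_ball_mono hec he0
  have hf0 : ∀ r, 0 ≤ f r := fun r => integral_nonneg he0
  obtain ⟨s, hs1, hs2, hs3⟩ := exists_small_increment hfm hf0 hL1 hr
  have hs0 : 0 < s := by linarith
  set S := ball (0 : E2) (s + 5 * L) \ ball (0 : E2) s with hSdef
  have hSm : MeasurableSet S := measurableSet_ball.diff measurableSet_ball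
  have hSb : ∀ x ∈ S, ‖x‖ ≤ s + 5 * L := fun x hx =>
    (by simpa using hx.1 : ‖x‖ < s + 5 * L).le
  have hSR : ∀ x ∈ S, x ∈ ball (0 : E2) R := fun x hx => ball_subset_ball (hs2.trans hrR) hx.1
  have hint : ∀ b, IntegrableOn (ed V v) (ball (0 : E2) b) := fun b =>
    hec.integrableOn_of_bounded (b := b) fun x hx => (by simpa using hx : ‖x‖ < b).le
  have hSint : ∫ x in S, ed V v x = f (s + 5 * L) - f s := by
    have := setIntegral_sdiff (μ := volume) measurableSet_ball (hint (s + 5 * L))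
      (ball_subset_ball (by linarith) : ball (0 : E2) s ⊆ ball 0 (s + 5 * L))
    simpa [hf, hSdef] using this
  have hac : ∫ x in S, ed V v x < c₁ := by
    rw [hSint]
    have : (f (s + 5 * L) - f s) * r < c₁ * r := lt_of_le_of_lt hs3 hsmall
    exact lt_of_mul_lt_mul_right this hr0.le
  have hgood : ∀ z : E2, s + L ≤ ‖z‖ → ‖z‖ ≤ s + 4 * L → V (v z) < c₀ := by
    intro z hz1 hz2
    by_contra! hbad
    have hzR : z ∈ ball (0 : E2) R := by simp; linarith
    refine absurd (hconc z hzR hbad) (not_le.2 (lt_of_le_of_lt ?_ hac))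
    refine setIntegral_mono_set (hec.integrableOn_of_bounded hSb) (Eventually.of_forall he0) ?_
    refine LE.le.eventuallyLE fun x hx => ?_
    have hx' : ‖x - z‖ < ρ := by simpa [dist_eq_norm] using hx
    have h1 : ‖x‖ ≤ ‖x - z‖ + ‖z‖ := by simpa using norm_add_le (x - z) z
    have h2 : ‖z‖ ≤ ‖x - z‖ + ‖x‖ := by
      have := norm_add_le (z - x) x
      rwa [sub_add_cancel, norm_sub_rev] at this
    refine ⟨by simp; linarith, by simp; linarith⟩
  obtain ⟨φ₁, h1s, h1nn, h1le, h1one, h1zero, h1b, h1z⟩ :=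
    hcut (s + L) (s + 2 * L) (by linarith) (by linarith)
  obtain ⟨φ₂, h2s, h2nn, h2le, h2one, h2zero, h2b, h2z⟩ :=
    hcut (s + 2 * L) (s + 3 * L) (by linarith) (by linarith)
  obtain ⟨φ₃, h3s, h3nn, h3le, h3one, h3zero, h3b, h3z⟩ :=
    hcut (s + 3 * L) (s + 4 * L) (by linarith) (by linarith)
  have hc2 : HasCompactSupport φ₂ := hasCompactSupport_of_zero_outside h2zero
  set ψ : E2 → ℝ := fun x => φ₃ x - φ₁ x with hψ
  have hψs : ContDiff ℝ (⊤ : ℕ∞) ψ := h3s.sub h1s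
  have hψout : ∀ x, s + 4 * L ≤ ‖x‖ → ψ x = 0 := fun x hx => by
    simp only [hψ]
    rw [h3zero x hx, h1zero x (by linarith), sub_zero]
  have hψin : ∀ x, ‖x‖ ≤ s + L → ψ x = 0 := fun x hx => by
    simp only [hψ]
    rw [h3one x (by linarith), h1one x hx, sub_self]
  have hψc : HasCompactSupport ψ := hasCompactSupport_of_zero_outside hψout
  have hψ0 : ∀ x, 0 ≤ ψ x := fun x => by
    simp only [hψ]
    rcases le_total ‖x‖ (s + 3 * L) with h | h
    · rw [h3one x h]; linarith [h1le x]
    · rw [h1zero x (by linarith)]; linarith [h3nn x]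
  have hψsupp : ∀ x, ψ x ≠ 0 → s + L < ‖x‖ ∧ ‖x‖ < s + 4 * L := fun x hx =>
    ⟨not_le.1 fun h => hx (hψin x h), not_le.1 fun h => hx (hψout x h)⟩
  have hpdψ : ∀ i x, pd ψ i x = pd φ₃ i x - pd φ₁ i x := fun i x =>
    pd_sub (diff_of_contDiff h3s x) (diff_of_contDiff h1s x) i
  have hψb : ∀ i x, |pd ψ i x| ≤ 2 * Cs / L := fun i x => by
    rw [hpdψ]
    have e1 := h1b i x
    have e3 := h3b i x
    have : (s + 2 * L) - (s + L) = L := by ring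
    rw [this] at e1
    have : (s + 4 * L) - (s + 3 * L) = L := by ring
    rw [this] at e3
    refine (abs_sub _ _).trans ?_
    have : 2 * Cs / L = Cs / L + Cs / L := by ring
    linarith
  set S₁ := closedBall (0 : E2) (s + 4 * L) \ ball (0 : E2) (s + L) with hS1
  have hS1S : S₁ ⊆ S := fun x hx => by
    have a1 : ‖x‖ ≤ s + 4 * L := by simpa using hx.1
    have a2 : s + L ≤ ‖x‖ := by simpa using hx.2
    exact ⟨by simp; linarith, by simp; linarith⟩
  have hψz : ∀ i x, x ∉ S₁ → pd ψ i x = 0 := fun i x hx => by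
    have : ‖x‖ < s + L ∨ s + 4 * L < ‖x‖ := by
      by_contra! h
      exact hx ⟨by simpa using h.2, by simpa using h.1⟩
    rw [hpdψ]
    rcases this with h | h
    · rw [h3z i x (Or.inl (by linarith)), h1z i x (Or.inl h), sub_zero]
    · rw [h3z i x (Or.inr h.le), h1z i x (Or.inr (by linarith)), sub_zero]
  have hS1m : MeasurableSet S₁ := measurableSet_closedBall.diff measurableSet_ball
  have hcacc := integral_cutoff_ed_le (B := 0) (D := 0) hV hv hT hψs hψc hψ0
    (fun x hx => hpde x (by simp; linarith [(hψsupp x hx).2]))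
    hS1m (fun x hx => hSb x (hS1S hx)) hC hψb hψz
    (fun x hx => (hT1 _ (hgood x (by simpa using hx.2) (by simpa using hx.1))).1)
    (fun x hx => by
      have := (hT1 _ (hgood x (hψsupp x hx).1.le (hψsupp x hx).2.le)).2.1
      linarith)
    (fun x hx i => by
      have := (hT1 _ (hgood x (hψsupp x hx).1.le (hψsupp x hx).2.le)).2.2 (pd v i x)
      nlinarith [sq_nonneg ‖pd v i x‖])
  have hS1le : ∫ x in S₁, ed V v x ≤ f (s + 5 * L) - f s := by
    rw [← hSint]
    exact setIntegral_mono_set (hec.integrableOn_of_bounded hSb) (Eventually.of_forall he0)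
      hS1S.eventuallyLE
  set S₂ := closedBall (0 : E2) (s + 3 * L) \ ball (0 : E2) (s + 2 * L) with hS2
  have hS2m : MeasurableSet S₂ := measurableSet_closedBall.diff measurableSet_ball
  have hS2b : ∀ x ∈ S₂, ‖x‖ ≤ s + 3 * L := fun x hx => by simpa using hx.1
  set m := ∫ x in S₂, ed V v x with hm
  have hm0 : 0 ≤ m := integral_nonneg he0
  have hmψ : m ≤ ∫ x, ψ x * ed V v x :=
    setIntegral_le_integral_mul hec he0 hψs.continuous hψc hψ0 hS2m hS2b fun x hx => by
      simp only [hψ]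
      rw [h3one x (hS2b x hx), h1zero x (by simpa using hx.2), sub_zero]
  have h2L : (s + 3 * L) - (s + 2 * L) = L := by ring
  have h2b' : ∀ i x, |pd φ₂ i x| ≤ Cs / L := fun i x => by
    have := h2b i x
    rwa [h2L] at this
  have h2z' : ∀ i x, x ∉ S₂ → pd φ₂ i x = 0 := fun i x hx => by
    have : ‖x‖ < s + 2 * L ∨ s + 3 * L < ‖x‖ := by
      by_contra! h
      exact hx ⟨by simpa using h.2, by simpa using h.1⟩
    rcases this with h | h
    · exact h2z i x (Or.inl h)
    · exact h2z i x (Or.inr h.le)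
  have h2supp : ∀ x, φ₂ x ≠ 0 → x ∈ ball (0 : E2) R := fun x hx => by
    have : ‖x‖ < s + 3 * L := not_le.1 fun h => hx (h2zero x h)
    simp
    linarith
  have hS2R : ∀ x ∈ S₂, x ∈ ball (0 : E2) R := fun x hx => by
    have := hS2b x hx
    simp
    linarith
  have hpoh := integral_pohozaev_le hV hV0 hv h2s hc2 (fun x hx => hpde x (h2supp x hx))
    hS2m hS2b h2b' h2z'
  have htest := integral_cutoff_ed_le (B := C + 1) (D := C * K ^ 2) hV hv hT h2s hc2 h2nn
    (fun x hx => hpde x (h2supp x hx)) hS2m hS2b hC h2b' h2z'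
    (fun x hx => (hT2 _ (hM x (hS2R x hx))).1)
    (fun x hx => by
      have := (hT2 _ (hM x (h2supp x hx))).2.1
      linarith)
    (fun x hx i => by
      have h := (hT2 _ (hM x (h2supp x hx))).2.2 (pd v i x)
      have h2 : ‖pd v i x‖ ^ 2 ≤ K ^ 2 := by
        have := hK x (h2supp x hx) i
        gcongr
      have h3 : C * V (v x) * ‖pd v i x‖ ^ 2 ≤ C * V (v x) * K ^ 2 := by
        have := hV0 (v x)
        gcongr
      nlinarith [sq_nonneg ‖pd v i x‖])
  have hfin : f (r / 2) ≤ ∫ x, φ₂ x * ed V v x :=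
    setIntegral_le_integral_mul hec he0 h2s.continuous hc2 h2nn measurableSet_ball
      (b := r / 2) (fun x hx => (by simpa using hx : ‖x‖ < r / 2).le) fun x hx => by
        have : ‖x‖ < r / 2 := by simpa using hx
        exact h2one x (by linarith)
  rw [zero_add, mul_zero, zero_mul, zero_add] at hcacc
  set a := f (s + 5 * L) - f s with ha
  have hm_le : m ≤ 2 * Cs / L * C * a :=
    (hmψ.trans hcacc).trans (mul_le_mul_of_nonneg_left hS1le (by positivity))
  exact decay_arith hB0 hCs.le (by linarith) hL0 (by linarith) hm0 (hf0 r) (by linarith)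
    (hfin.trans htest) hpoh hm_le hs3 (by rw [hL, hQ]; linarith)

theorem exists_radius_of_decay {f : ℝ → ℝ} {L η R : ℝ} (hL : 0 < L)
    (h : ∀ r, 10 * L ≤ r → r ≤ R → f r ≤ η * r → f (r / 2) ≤ f r / 2) (n : ℕ) :
    ∀ r, r ≤ R → r < 10 * L * 2 ^ n → f r ≤ η * r →
      ∃ r', (r' = r ∨ 5 * L ≤ r') ∧ r' < 10 * L ∧ f r' ≤ η * r' := by
  induction n with
  | zero => exact fun r _ hr hf => ⟨r, Or.inl rfl, by simpa using hr, hf⟩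
  | succ n ih =>
    intro r hrR hr hf
    rcases lt_or_ge r (10 * L) with hlt | hge
    · exact ⟨r, Or.inl rfl, hlt, hf⟩
    · obtain ⟨r', h1, h2, h3⟩ := ih (r / 2) (by linarith) (by rw [pow_succ] at hr; linarith)
        (by linarith [h r hge hrR hf])
      exact ⟨r', Or.inr (h1.elim (fun h => by linarith) id), h2, h3⟩

end Decay

section Slices

theorem exists_measurableEquiv_plane (i : Fin 2) : ∃ e : ℝ × ℝ ≃ᵐ E2,
    MeasurePreserving e volume volume ∧ ∀ p, e p = p.1 • b2 i + p.2 • b2 (1 - i) := by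
  set e : ℝ × ℝ ≃ᵐ E2 := MeasurableEquiv.finTwoArrow.symm.trans (MeasurableEquiv.toLp 2 (Fin 2 → ℝ))
    with he
  have hmp : MeasurePreserving e volume volume :=
    (PiLp.volume_preserving_toLp (Fin 2)).comp
      ((volume_preserving_finTwoArrow ℝ).symm MeasurableEquiv.finTwoArrow)
  have hev : ∀ p, e p = p.1 • b2 0 + p.2 • b2 1 := by
    intro p
    ext j
    fin_cases j <;> simp [he, b2, MeasurableEquiv.finTwoArrow, MeasurableEquiv.piFinTwo]
  fin_cases i
  · exact ⟨e, hmp, hev⟩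
  · refine ⟨MeasurableEquiv.prodComm.trans e, hmp.comp Measure.measurePreserving_swap, fun p => ?_⟩
    change e p.swap = _
    rw [hev]
    simp [add_comm]

theorem slice_apply_self (i : Fin 2) (s t : ℝ) : (s • b2 i + t • b2 (1 - i)) i = s := by
  fin_cases i <;> simp [b2]

theorem slice_apply_other (i : Fin 2) (s t : ℝ) : (s • b2 i + t • b2 (1 - i)) (1 - i) = t := by
  fin_cases i <;> simp [b2]

theorem slice_eq (i : Fin 2) (x : E2) : x i • b2 i + x (1 - i) • b2 (1 - i) = x := by
  ext j
  refine fin2_cases i (fun j => (x i • b2 i + x (1 - i) • b2 (1 - i)) j = x j) ?_ ?_ j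
  · rw [slice_apply_self]
  · rw [slice_apply_other]

theorem norm_sq_eq_coord (i : Fin 2) (x : E2) : ‖x‖ ^ 2 = x i ^ 2 + x (1 - i) ^ 2 := by
  rw [EuclideanSpace.norm_sq_eq, Fin.sum_univ_two]
  fin_cases i <;> simp [add_comm]

/-- A nonnegative function has a slice on which its integral is at most the average. -/
theorem exists_slice {f : E2 → ℝ} (hf : Continuous f) (hf0 : ∀ x, 0 ≤ f x) (i : Fin 2)
    {a b c d R : ℝ} (hab : a < b)
    (hR : ∀ s ∈ Set.Ioo a b, ∀ t ∈ Set.Icc c d, s ^ 2 + t ^ 2 < R ^ 2) (hR0 : 0 < R) :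
    ∃ s ∈ Set.Ioo a b, (b - a) * (∫ t in Set.Icc c d, f (s • b2 i + t • b2 (1 - i))) ≤
      ∫ x in ball (0 : E2) R, f x := by
  obtain ⟨e, he, hev⟩ := exists_measurableEquiv_plane i
  set S : Set E2 := e '' (Set.Ioo a b ×ˢ Set.Icc c d) with hS
  have hSb : S ⊆ ball (0 : E2) R := by
    rintro _ ⟨p, ⟨hp1, hp2⟩, rfl⟩
    have h := hR p.1 hp1 p.2 hp2
    have h2 := norm_sq_eq_coord i (e p)
    rw [hev, slice_apply_self, slice_apply_other, ← hev] at h2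
    rw [← h2] at h
    simpa using lt_of_pow_lt_pow_left₀ 2 hR0.le h
  have hcont : Continuous fun p : ℝ × ℝ => f (p.1 • b2 i + p.2 • b2 (1 - i)) := by fun_prop
  have hint : IntegrableOn (fun p : ℝ × ℝ => f (p.1 • b2 i + p.2 • b2 (1 - i)))
      (Set.Ioo a b ×ˢ Set.Icc c d) (volume.prod volume) :=
    (hcont.continuousOn.integrableOn_compact (isCompact_Icc.prod isCompact_Icc)).mono_set
      (Set.prod_mono Set.Ioo_subset_Icc_self (le_refl (Set.Icc c d)))
  have h1 : ∫ p in Set.Ioo a b ×ˢ Set.Icc c d, f (p.1 • b2 i + p.2 • b2 (1 - i)) =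
      ∫ x in S, f x := by
    have := he.setIntegral_preimage_emb e.measurableEmbedding f S
    have hpre : e ⁻¹' S = Set.Ioo a b ×ˢ Set.Icc c d := Set.preimage_image_eq _ e.injective
    rw [hpre] at this
    rw [← this]
    simp only [hev]
  have h2 := setIntegral_prod _ hint
  have h3 : ∫ x in S, f x ≤ ∫ x in ball (0 : E2) R, f x :=
    setIntegral_mono_set (hf.integrableOn_of_bounded (b := R) fun x hx =>
      (by simpa using hx : ‖x‖ < R).le) (Eventually.of_forall hf0) (LE.le.eventuallyLE hSb)
  have hintm : IntegrableOn (fun s => ∫ t in Set.Icc c d, f (s • b2 i + t • b2 (1 - i)))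
      (Set.Ioo a b) := by
    rw [IntegrableOn, ← Measure.prod_restrict] at hint
    exact hint.integral_prod_left
  obtain ⟨s, hs, hle⟩ := exists_le_setAverage (μ := volume) (s := Set.Ioo a b)
    (by simp [hab]) (by simp) hintm
  refine ⟨s, hs, ?_⟩
  rw [setAverage_eq, Real.volume_real_Ioo_of_le hab.le, smul_eq_mul] at hle
  have hba : 0 < b - a := sub_pos.2 hab
  have h4 := mul_le_mul_of_nonneg_left hle hba.le
  rw [mul_inv_cancel_left₀ hba.ne'] at h4
  rw [← h2] at h4
  refine h4.trans (le_trans (le_of_eq ?_) h3)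
  rw [← h1]
  rfl

end Slices

section SupBound

variable {k : ℕ}

/-- A curve of small energy stays bounded. -/
theorem norm_le_of_line_energy {V : Evec k → ℝ} (hV : Continuous V) (hV0 : ∀ y, 0 ≤ V y) {M₀ : ℝ}
    (hM₀ : ∀ y, M₀ ≤ ‖y‖ → 1 ≤ V y) {c c' : ℝ → Evec k} (hc : ∀ t, HasDerivAt c (c' t) t)
    (hc' : Continuous c') {a b h : ℝ} (hab : a < b) (h1 : h ≤ 1) (hba : h < b - a)
    (hE : ∫ t in Set.Icc a b, (2⁻¹ * ‖c' t‖ ^ 2 + V (c t)) ≤ h) {t : ℝ} (ht : t ∈ Set.Icc a b) :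
    ‖c t‖ ≤ M₀ + 1 := by
  have hcc : Continuous c := continuous_iff_continuousAt.2 fun t => (hc t).continuousAt
  have hec : Continuous fun t => 2⁻¹ * ‖c' t‖ ^ 2 + V (c t) := by fun_prop
  have he0 : ∀ t, 0 ≤ 2⁻¹ * ‖c' t‖ ^ 2 + V (c t) := fun t => by
    have := hV0 (c t)
    positivity
  have heint : IntegrableOn (fun t => 2⁻¹ * ‖c' t‖ ^ 2 + V (c t)) (Set.Icc a b) :=
    hec.continuousOn.integrableOn_compact isCompact_Icc
  have hex : ∃ t₀ ∈ Set.Icc a b, ‖c t₀‖ ≤ M₀ := by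
    by_contra! hn
    have : ∫ _ in Set.Icc a b, (1 : ℝ) ≤ ∫ t in Set.Icc a b, (2⁻¹ * ‖c' t‖ ^ 2 + V (c t)) := by
      refine setIntegral_mono_on (by simp) heint measurableSet_Icc fun t ht => ?_
      have := hM₀ _ (hn t ht).le
      have : 0 ≤ 2⁻¹ * ‖c' t‖ ^ 2 := by positivity
      linarith
    rw [setIntegral_const, Real.volume_real_Icc_of_le hab.le] at this
    simp only [smul_eq_mul, mul_one] at this
    linarith
  set A : Set ℝ := Set.Icc a b ∩ {s | ‖c s‖ ≤ M₀} with hA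
  have hAc : IsCompact A := isCompact_Icc.inter_right (isClosed_le hcc.norm continuous_const)
  obtain ⟨s, hs, hmin⟩ := hAc.exists_isMinOn (f := fun s => |s - t|)
    (by obtain ⟨t₀, h, h'⟩ := hex; exact ⟨t₀, h, h'⟩) (by fun_prop)
  have hsub : Set.uIoc s t ⊆ Set.Icc a b := fun r hr => by
    have : r ∈ Set.uIcc s t := Set.uIoc_subset_uIcc hr
    exact Set.uIcc_subset_Icc hs.1 ht this
  have hlarge : ∀ r ∈ Set.uIoc s t, r ≠ s → M₀ < ‖c r‖ := by
    intro r hr hrs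
    by_contra! hle
    have h := hmin (⟨hsub hr, hle⟩ : r ∈ A)
    simp only [Set.mem_ofPred_eq] at h
    rcases le_total s t with hst | hst
    · rw [Set.uIoc_of_le hst] at hr
      rw [abs_of_nonpos (by linarith), abs_of_nonpos (by linarith [hr.2])] at h
      linarith [hr.1]
    · rw [Set.uIoc_of_ge hst] at hr
      rw [abs_of_nonneg (by linarith), abs_of_nonneg (by linarith [hr.1])] at h
      exact hrs (le_antisymm hr.2 (by linarith))
  have hftc : ∫ r in s..t, c' r = c t - c s :=
    intervalIntegral.integral_eq_sub_of_hasDerivAt (fun r _ => hc r) (hc'.intervalIntegrable _ _)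
  have hle : ‖c t - c s‖ ≤ 1 := by
    rw [← hftc]
    refine intervalIntegral.norm_integral_le_integral_norm_uIoc.trans ?_
    refine le_trans ?_ ((setIntegral_mono_set heint (Eventually.of_forall he0)
      (LE.le.eventuallyLE hsub)).trans (hE.trans h1))
    refine setIntegral_mono_ae_restrict ?_ (heint.mono_set hsub) ?_
    · exact (hc'.norm.continuousOn.integrableOn_compact isCompact_Icc).mono_set hsub
    · rw [EventuallyLE, ae_restrict_iff' measurableSet_uIoc]
      filter_upwards [Measure.ae_ne volume s] with r hr hrI
      have := hM₀ _ (hlarge r hrI hr).le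
      nlinarith [sq_nonneg (‖c' r‖ - 1)]
  have h5 : ‖c s‖ ≤ M₀ := hs.2
  have := norm_sub_norm_le (c t) (c s)
  linarith

end SupBound

section ClearingOut

variable {k : ℕ}

theorem mem_ball_of_coord {x : E2} {d R : ℝ} (hd : ∀ i, |x i| ≤ d) (hR : 0 < R)
    (h : 2 * d ^ 2 < R ^ 2) : x ∈ ball (0 : E2) R := by
  have h2 := norm_sq_eq_coord 0 x
  have e0 : x 0 ^ 2 ≤ d ^ 2 := sq_le_sq' (abs_le.1 (hd 0)).1 (abs_le.1 (hd 0)).2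
  have e1 : x 1 ^ 2 ≤ d ^ 2 := sq_le_sq' (abs_le.1 (hd 1)).1 (abs_le.1 (hd 1)).2
  have h3 : ‖x‖ ^ 2 < R ^ 2 := by
    rw [h2, sub_zero]
    linarith
  simpa using lt_of_pow_lt_pow_left₀ 2 hR.le h3

theorem laplacian_norm_sq {v : E2 → Evec k} (hv : ContDiff ℝ (⊤ : ℕ∞) v) (x : E2) :
    ∑ i, pd (pd (fun y => ⟪v y, v y⟫) i) i x =
      2 * (‖pd v 0 x‖ ^ 2 + ‖pd v 1 x‖ ^ 2 + ⟪v x, ∑ i, pd (pd v i) i x⟫) := by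
  have h1 : ∀ i, pd (fun y => ⟪v y, v y⟫) i = fun y => 2 * ⟪v y, pd v i y⟫ := fun i => by
    funext y
    rw [pd_inner (diff_of_contDiff hv y) (diff_of_contDiff hv y), real_inner_comm]
    ring
  have h2 : ∀ i, pd (pd (fun y => ⟪v y, v y⟫) i) i x =
      2 * (‖pd v i x‖ ^ 2 + ⟪v x, pd (pd v i) i x⟫) := fun i => by
    have hd := diff_of_contDiff (contDiff_pd hv i)
    have hd' : DifferentiableAt ℝ (fun y => ⟪v y, pd v i y⟫) x :=
      (diff_of_contDiff hv x).inner ℝ (hd x)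
    rw [h1, pd_mul (differentiableAt_const _) hd', pd_const,
      pd_inner (diff_of_contDiff hv x) (hd x), real_inner_self_eq_norm_sq]
    ring
  rw [Fin.sum_univ_two, Fin.sum_univ_two, h2, h2, inner_add_right]
  ring

/-- The bound on the modulus of a solution of small energy. -/
theorem norm_le_of_small_energy {V : Evec k → ℝ} (hV : ContDiff ℝ (⊤ : ℕ∞) V)
    (hV0 : ∀ y, 0 ≤ V y) {M₀ R₁ α : ℝ} (hM₀ : ∀ y, M₀ ≤ ‖y‖ → 1 ≤ V y) (hα : 0 < α) (hR₁ : 0 < R₁)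
    (hgr : ∀ y : Evec k, R₁ < ‖y‖ → α * ‖y‖ ^ 2 ≤ ⟪y, gradient V y⟫)
    {v : E2 → Evec k} (hv : ContDiff ℝ (⊤ : ℕ∞) v) {R η : ℝ} (hR : 0 < R) (hη1 : 4 * η ≤ 1)
    (hηR : 4 * η < R) (hpde : ∀ x ∈ ball (0 : E2) R, ∑ i, pd (pd v i) i x = gradient V (v x))
    (hE : ∫ x in ball (0 : E2) R, ed V v x ≤ η * R) {x : E2} (hx : ∀ i, |x i| ≤ R / 4) :
    ‖v x‖ ≤ max (M₀ + 1) R₁ := by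
  set M := max (M₀ + 1) R₁ with hM
  have hM0 : 0 < M := lt_max_of_lt_right hR₁
  have hec := continuous_ed hV hv
  have he0 := ed_nonneg hV0 v
  have hslice : ∀ i : Fin 2, ∀ a b : ℝ, b - a = R / 4 → -(R / 2) ≤ a → b ≤ R / 2 →
      ∃ s ∈ Set.Ioo a b, ∀ t ∈ Set.Icc (-(R / 2)) (R / 2),
        ‖v (s • b2 i + t • b2 (1 - i))‖ ≤ M₀ + 1 := by
    intro i a b hba ha hb
    obtain ⟨s, hs, hle⟩ := exists_slice hec he0 i (a := a) (b := b) (c := -(R / 2)) (d := R / 2)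
      (R := R) (by linarith) (fun s hs t ht => by
        have h1 : s ^ 2 ≤ (R / 2) ^ 2 := sq_le_sq' (by linarith [hs.1]) (by linarith [hs.2])
        have h2 : t ^ 2 ≤ (R / 2) ^ 2 := sq_le_sq' ht.1 ht.2
        nlinarith) hR
    refine ⟨s, hs, fun t ht => ?_⟩
    have hline : ∀ t, HasDerivAt (fun t : ℝ => v (s • b2 i + t • b2 (1 - i)))
        (pd v (1 - i) (s • b2 i + t • b2 (1 - i))) t :=
      fun t => hasDerivAt_line (diff_of_contDiff hv) _ _ t
    have hpc : ∀ j, Continuous fun t : ℝ => pd v j (s • b2 i + t • b2 (1 - i)) := fun j =>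
      (contDiff_pd hv j).continuous.comp (by fun_prop)
    have hVc : Continuous fun t : ℝ => V (v (s • b2 i + t • b2 (1 - i))) :=
      (hV.continuous.comp hv.continuous).comp (by fun_prop)
    refine norm_le_of_line_energy hV.continuous hV0 hM₀ (a := -(R / 2)) (b := R / 2) (h := 4 * η)
      hline (hpc (1 - i)) (by linarith) hη1 (by linarith) ?_ ht
    have h1 : ∫ t in Set.Icc (-(R / 2)) (R / 2), (2⁻¹ * ‖pd v (1 - i) (s • b2 i + t • b2 (1 - i))‖ ^ 2
        + V (v (s • b2 i + t • b2 (1 - i)))) ≤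
        ∫ t in Set.Icc (-(R / 2)) (R / 2), ed V v (s • b2 i + t • b2 (1 - i)) := by
      refine setIntegral_mono ?_ ?_ fun t => ?_
      · exact ((continuous_const.mul ((hpc (1 - i)).norm.pow 2)).add hVc).continuousOn
          |>.integrableOn_compact isCompact_Icc
      · exact (hec.comp (by fun_prop)).continuousOn.integrableOn_compact isCompact_Icc
      · unfold ed
        refine fin2_cases 0 (fun j => 2⁻¹ * ‖pd v j (s • b2 i + t • b2 (1 - i))‖ ^ 2
          + V (v (s • b2 i + t • b2 (1 - i))) ≤ _) ?_ ?_ (1 - i)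
        · linarith [sq_nonneg ‖pd v 1 (s • b2 i + t • b2 (1 - i))‖]
        · rw [sub_zero]
          linarith [sq_nonneg ‖pd v 0 (s • b2 i + t • b2 (1 - i))‖]
    rw [hba] at hle
    have h2 := hle.trans hE
    refine h1.trans ?_
    nlinarith
  choose a ha ha' using fun i => hslice i (-(R / 2)) (-(R / 4)) (by ring) le_rfl (by linarith)
  choose b hb hb' using fun i => hslice i (R / 4) (R / 2) (by ring) (by linarith) le_rfl
  have hcoord : ∀ y : E2, (∀ i, a i ≤ y i ∧ y i ≤ b i) → ∀ i, |y i| ≤ R / 2 := fun y hy i =>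
    abs_le.2 ⟨by linarith [(hy i).1, (ha i).1], by linarith [(hy i).2, (hb i).2]⟩
  have hsq : ContDiff ℝ (⊤ : ℕ∞) fun y => ⟪v y, v y⟫ := hv.inner ℝ hv
  have key : ⟪v x, v x⟫ ≤ M ^ 2 := by
    refine le_of_laplacian_pos hsq (a := a) (b := b) (B := M ^ 2) (fun y hy hMy => ?_)
      (fun y hy hbd => ?_) x fun i => ?_
    · have hyR : y ∈ ball (0 : E2) R :=
        mem_ball_of_coord (hcoord y fun i => ⟨(hy i).1.le, (hy i).2.le⟩) hR (by nlinarith)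
      rw [laplacian_norm_sq hv, hpde y hyR]
      rw [real_inner_self_eq_norm_sq] at hMy
      have hlt : M < ‖v y‖ := lt_of_pow_lt_pow_left₀ 2 (norm_nonneg _) hMy
      have h1 := hgr (v y) ((le_max_right _ _).trans_lt hlt)
      have h2 : 0 < α * ‖v y‖ ^ 2 := by
        have : 0 < ‖v y‖ := hM0.trans hlt
        positivity
      nlinarith [sq_nonneg ‖pd v 0 y‖, sq_nonneg ‖pd v 1 y‖]
    · have hle : ‖v y‖ ≤ M := by
        obtain ⟨i, hi⟩ := hbd
        have hother := abs_le.1 (hcoord y hy (1 - i))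
        rw [← slice_eq i y]
        rcases hi with hi | hi
        · rw [hi]
          exact (ha' i _ hother).trans (le_max_left _ _)
        · rw [hi]
          exact (hb' i _ hother).trans (le_max_left _ _)
      rw [real_inner_self_eq_norm_sq]
      gcongr
    · have := abs_le.1 (hx i)
      exact ⟨by linarith [(ha i).2], by linarith [(hb i).1]⟩
  rw [real_inner_self_eq_norm_sq] at key
  exact le_of_sq_le_sq key hM0.le

/-- The interior gradient bound. -/
theorem exists_gradient_bound {V : Evec k → ℝ} (hV : ContDiff ℝ (⊤ : ℕ∞) V) (M : ℝ) {d : ℝ}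
    (hd : 0 < d) : ∃ K > (0 : ℝ), ∀ v : E2 → Evec k, ContDiff ℝ (⊤ : ℕ∞) v → ∀ z : E2,
      (∀ x : E2, (∀ i, |x i| ≤ d) → ‖v (z + x)‖ ≤ M ∧
        ∑ i, pd (pd v i) i (z + x) = gradient V (v (z + x))) → ∀ i, ‖pd v i z‖ ≤ K := by
  obtain ⟨G, hG⟩ := (isCompact_closedBall (0 : Evec k) M).exists_bound_of_continuousOn
    (continuous_gradient hV).continuousOn
  refine ⟨2 * |M| / d + |G| * d / 2 + d / 2 + 1, by positivity, fun v hv z hz i => ?_⟩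
  set ν := pd v i z with hν
  set w : E2 → ℝ := fun x => ⟪v (z + ContinuousLinearMap.id ℝ E2 x), ν⟫ with hw
  have hL : ∀ j, (ContinuousLinearMap.id ℝ E2) (b2 j) = (fun _ => (1 : ℝ)) j • b2 j := fun j => by
    simp
  have hvz : ContDiff ℝ (⊤ : ℕ∞) fun x : E2 => v (z + ContinuousLinearMap.id ℝ E2 x) :=
    hv.comp (contDiff_const.add contDiff_id)
  have hws : ContDiff ℝ (⊤ : ℕ∞) w := hvz.inner ℝ contDiff_const
  have hpin : ∀ {g : E2 → Evec k}, ContDiff ℝ (⊤ : ℕ∞) g → ∀ j,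
      pd (fun x => ⟪g x, ν⟫) j = fun x => ⟪pd g j x, ν⟫ := fun hg j => by
    funext x
    rw [pd_inner (diff_of_contDiff hg x) (differentiableAt_const _), pd_const]
    simp
  have h1 : ∀ j, pd w j = fun x => ⟪pd (fun x => v (z + ContinuousLinearMap.id ℝ E2 x)) j x, ν⟫ :=
    fun j => hpin hvz j
  have h2 : ∀ j x, pd (pd w j) j x = ⟪pd (pd v j) j (z + x), ν⟫ := fun j x => by
    rw [h1, hpin (contDiff_pd hvz j)]
    beta_reduce
    rw [pd_pd_comp_affine hv hL]
    simp
  have hsum : ∀ x, ∑ j, pd (pd w j) j x = ⟪∑ j, pd (pd v j) j (z + x), ν⟫ := fun x => by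
    rw [sum_inner]
    exact Finset.sum_congr rfl fun j _ => h2 j x
  have hb := pd_le_of_laplacian_bound hws (M := |M| * ‖ν‖) (N := |G| * ‖ν‖ + 1) hd (fun x hx => by
      refine (abs_real_inner_le_norm _ _).trans ?_
      gcongr
      exact (hz x hx).1.trans (le_abs_self M)) (fun x hx => by
      rw [hsum, (hz x hx).2]
      refine lt_of_le_of_lt (abs_real_inner_le_norm _ _) (lt_of_le_of_lt ?_ (lt_add_one _))
      gcongr
      exact (hG _ (by simpa using (hz x hx).1)).trans (le_abs_self G)) i
  have h0 : pd w i 0 = ‖ν‖ ^ 2 := by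
    rw [h1]
    simp only
    rw [pd_comp_affine (diff_of_contDiff hv) hL]
    simp [hν]
  rw [h0] at hb
  by_contra! hlt
  set P := 2 * |M| / d + |G| * d / 2 with hP
  have hP0 : 0 ≤ P := by positivity
  have h3 : 2 * (|M| * ‖ν‖) / d + (|G| * ‖ν‖ + 1) * d / 2 = P * ‖ν‖ + d / 2 := by
    rw [hP]
    field_simp
    ring
  rw [h3] at hb
  nlinarith

theorem norm_fderiv_le_of_pd {v : E2 → Evec k} {x : E2} {K : ℝ} (h : ∀ i, ‖pd v i x‖ ≤ K) :
    ‖fderiv ℝ v x‖ ≤ 2 * K := by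
  have hK : 0 ≤ K := (norm_nonneg _).trans (h 0)
  refine ContinuousLinearMap.opNorm_le_bound _ (by positivity) fun w => ?_
  have hw : fderiv ℝ v x w = w 0 • pd v 0 x + w 1 • pd v 1 x := by
    conv_lhs => rw [← slice_eq 0 w]
    rw [map_add, map_smul, map_smul]
    rfl
  rw [hw]
  refine (norm_add_le _ _).trans ?_
  rw [norm_smul, norm_smul]
  have h0 := mul_le_mul (abs_coord_le_norm w 0) (h 0) (norm_nonneg _) (norm_nonneg _)
  have h1 := mul_le_mul (abs_coord_le_norm w 1) (h 1) (norm_nonneg _) (norm_nonneg _)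
  simp only [Real.norm_eq_abs]
  linarith

/-- Points where the potential is not small carry a fixed amount of energy. -/
theorem exists_energy_lower_bound {V : Evec k → ℝ} (hV : ContDiff ℝ (⊤ : ℕ∞) V)
    (M : ℝ) {K c₀ d : ℝ} (hK : 0 < K) (hc₀ : 0 < c₀) (hd : 0 < d) :
    ∃ ρ > (0 : ℝ), ρ ≤ d ∧ ∃ c₁ > (0 : ℝ), ∀ v : E2 → Evec k, ContDiff ℝ (⊤ : ℕ∞) v → ∀ z : E2,
      (∀ x ∈ ball z ρ, ‖v x‖ ≤ M ∧ ∀ i, ‖pd v i x‖ ≤ K) → c₀ ≤ V (v z) →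
        c₁ ≤ ∫ x in ball z ρ, ed V v x := by
  have hdc : Continuous (fderiv ℝ V) := hV.continuous_fderiv (by simp)
  obtain ⟨G, hG⟩ := (isCompact_closedBall (0 : Evec k) M).exists_bound_of_continuousOn
    hdc.continuousOn
  set D := |G| * (2 * K) + 1 with hD
  have hD0 : 0 < D := by positivity
  set ρ := min d (c₀ / (2 * D)) with hρ
  have hρ0 : 0 < ρ := lt_min hd (by positivity)
  have hDρ : D * ρ ≤ c₀ / 2 := by
    have : ρ ≤ c₀ / (2 * D) := min_le_right _ _
    rw [le_div_iff₀ (by positivity)] at this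
    linarith
  have hvol : 0 < (volume (ball (0 : E2) ρ)).toReal :=
    ENNReal.toReal_pos (measure_ball_pos _ _ hρ0).ne' measure_ball_lt_top.ne
  refine ⟨ρ, hρ0, min_le_left _ _, c₀ / 2 * (volume (ball (0 : E2) ρ)).toReal, by positivity,
    fun v hv z hz hbad => ?_⟩
  have hlip : ∀ x ∈ ball z ρ, c₀ / 2 ≤ V (v x) := by
    intro x hx
    have hdV := diff_of_contDiff hV
    have hdv := diff_of_contDiff hv
    have h := Convex.norm_image_sub_le_of_norm_fderiv_le (𝕜 := ℝ) (f := V ∘ v) (s := ball z ρ)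
      (C := D) (fun y _ => (hdV _).comp y (hdv y)) (fun y hy => by
        rw [fderiv_comp y (hdV _) (hdv y)]
        refine (ContinuousLinearMap.opNorm_comp_le _ _).trans ?_
        have h1 : ‖fderiv ℝ V (v y)‖ ≤ |G| :=
          (hG _ (by simpa using (hz y hy).1)).trans (le_abs_self G)
        have h2 := norm_fderiv_le_of_pd (hz y hy).2
        have := mul_le_mul h1 h2 (norm_nonneg _) (abs_nonneg _)
        linarith) (convex_ball z ρ) hx (mem_ball_self hρ0)
    have hzx : ‖z - x‖ ≤ ρ := by
      rw [mem_ball', dist_eq_norm] at hx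
      exact hx.le
    have h3 : ‖(V ∘ v) z - (V ∘ v) x‖ ≤ c₀ / 2 :=
      (h.trans (mul_le_mul_of_nonneg_left hzx hD0.le)).trans hDρ
    have h4 := (abs_le.1 h3).2
    simp only [Function.comp_apply] at h4
    linarith
  have hcst : ∫ _ in ball z ρ, c₀ / 2 = c₀ / 2 * (volume (ball (0 : E2) ρ)).toReal := by
    rw [setIntegral_const, measureReal_def, Measure.addHaar_ball_center, smul_eq_mul, mul_comm]
  rw [← hcst]
  refine setIntegral_mono_on (integrableOn_const measure_ball_lt_top.ne) ?_ measurableSet_ball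
    fun x hx => (hlip x hx).trans ?_
  · exact ((continuous_ed hV hv).continuousOn.integrableOn_compact
      (isCompact_closedBall z ρ)).mono_set ball_subset_closedBall
  · unfold ed
    have : 0 ≤ 2⁻¹ * (‖pd v 0 x‖ ^ 2 + ‖pd v 1 x‖ ^ 2) := by positivity
    linarith

/-- The clearing-out property at unit scale, on disks of arbitrary size. -/
theorem exists_clearing_out {V : Evec k → ℝ} (hV : IsMultiWell V) {μ₀ : ℝ} (hμ₀ : 0 < μ₀)
    (hdisj : ∀ σ σ' : Evec k, V σ = 0 → V σ' = 0 → σ ≠ σ' →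
      Disjoint (ball σ (2 * μ₀)) (ball σ' (2 * μ₀)))
    (hhess : ∀ σ : Evec k, V σ = 0 → ∃ lm lp : ℝ, 0 < lm ∧ lm ≤ lp ∧
      ∀ y ∈ ball σ (2 * μ₀), ∀ w : Evec k,
        lm / 2 * ‖w‖ ^ 2 ≤ iteratedFDeriv ℝ 2 V y ![w, w] ∧
        iteratedFDeriv ℝ 2 V y ![w, w] ≤ 2 * lp * ‖w‖ ^ 2) {R₀ : ℝ} (hR₀ : 0 < R₀) :
    ∃ T : Evec k → Evec k, ContDiff ℝ (⊤ : ℕ∞) T ∧ ∃ c₀ > (0 : ℝ), ∃ C ≥ (1 : ℝ),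
      (∀ y, V y < c₀ → ∃ σ, V σ = 0 ∧ ‖y - σ‖ < μ₀ / 2) ∧
      (∀ y, V y < c₀ → ‖T y‖ ^ 2 ≤ C * V y ∧ V y ≤ ⟪gradient V y, T y⟫ ∧
        ∀ w, ⟪fderiv ℝ T y w, w⟫ = ‖w‖ ^ 2) ∧
      ∃ η > (0 : ℝ), ∀ R ≥ R₀, ∀ v : E2 → Evec k, ContDiff ℝ (⊤ : ℕ∞) v →
        (∀ x ∈ ball (0 : E2) R, ∑ i, pd (pd v i) i x = gradient V (v x)) →
        ∫ x in ball (0 : E2) R, ed V v x ≤ η * R → V (v 0) < c₀ := by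
  have hVs := hV.smooth
  have hV0 := hV.nonneg
  obtain ⟨M₀, hM₀⟩ := hV.coercive 1
  obtain ⟨α, hα, R₁, hR₁, hgr⟩ := hV.growth
  set M := max (M₀ + 1) R₁ with hM
  obtain ⟨T, hT, c₀, hc₀, C, hC, hnear, hT1, hT2⟩ := exists_test_field hV hμ₀ hdisj hhess M
  refine ⟨T, hT, c₀, hc₀, C, hC, hnear, hT1, ?_⟩
  have hd : 0 < R₀ / 16 := by positivity
  obtain ⟨K, hK, hgrad⟩ := exists_gradient_bound hVs M hd
  obtain ⟨ρ, hρ0, hρd, c₁, hc₁, hconc⟩ :=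
    exists_energy_lower_bound hVs M hK hc₀ (lt_min hd one_pos)
  have hρ1 : ρ ≤ 1 := hρd.trans (min_le_right _ _)
  have hρR : ρ ≤ R₀ / 16 := hρd.trans (min_le_left _ _)
  obtain ⟨L, hL1, hdecay⟩ := energy_decay (K := K) (c₁ := c₁) hVs hV0 hT hC hρ1 hT1 hT2
  have hL0 : 0 < L := by linarith
  set η := min (1 / 4) (min (R₀ / 8) (c₁ / (640 * L))) with hη
  have hη0 : 0 < η := by positivity
  have hη1 : η ≤ 1 / 4 := min_le_left _ _
  have hη2 : η ≤ R₀ / 8 := (min_le_right _ _).trans (min_le_left _ _)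
  have hη3 : 640 * L * η ≤ c₁ := by
    have : η ≤ c₁ / (640 * L) := (min_le_right _ _).trans (min_le_right _ _)
    rw [le_div_iff₀ (by positivity)] at this
    linarith
  refine ⟨η, hη0, fun R hR v hv hpde hE => ?_⟩
  have hRp : 0 < R := by linarith
  have hsup : ∀ x : E2, (∀ i, |x i| ≤ R / 4) → ‖v x‖ ≤ M := fun x hx =>
    norm_le_of_small_energy hVs hV0 hM₀ hα hR₁ hgr hv hRp (by linarith) (by linarith) hpde hE hx
  have hcb : ∀ {x : E2} {r : ℝ}, x ∈ ball (0 : E2) r → ∀ i, |x i| ≤ r := fun {x r} hx i =>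
    (abs_coord_le_norm x i).trans (by simpa using hx : ‖x‖ < r).le
  have hgrad' : ∀ z ∈ ball (0 : E2) (R / 8), ∀ i, ‖pd v i z‖ ≤ K := fun z hz =>
    hgrad v hv z fun x hx => by
      have hzx : ∀ i, |(z + x) i| ≤ R / 4 := fun i => by
        have h1 := hcb hz i
        have h2 := hx i
        have h3 := abs_add_le (z i) (x i)
        rw [PiLp.add_apply]
        linarith
      exact ⟨hsup _ hzx, hpde _ (mem_ball_of_coord hzx hRp (by nlinarith))⟩
  have hsup' : ∀ z ∈ ball (0 : E2) (R / 8), ‖v z‖ ≤ M := fun z hz =>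
    hsup z fun i => (hcb hz i).trans (by linarith)
  have hsub : ball (0 : E2) (R / 16) ⊆ ball (0 : E2) (R / 8) := ball_subset_ball (by linarith)
  have hconc' : ∀ z ∈ ball (0 : E2) (R / 16), c₀ ≤ V (v z) → c₁ ≤ ∫ x in ball z ρ, ed V v x := by
    intro z hz hbad
    refine hconc v hv z (fun x hx => ?_) hbad
    have hx8 : x ∈ ball (0 : E2) (R / 8) := by
      rw [mem_ball] at hx hz ⊢
      linarith [dist_triangle x z 0]
    exact ⟨hsup' x hx8, hgrad' x hx8⟩
  have hdec := hdecay v hv (R / 16)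
    (fun x hx => hpde x (ball_subset_ball (by linarith) hx))
    (fun x hx => hsup' x (hsub hx)) (fun x hx => hgrad' x (hsub hx)) hconc'
  set f : ℝ → ℝ := fun r => ∫ x in ball (0 : E2) r, ed V v x with hf
  have hfm : Monotone f := setIntegral_ball_mono (continuous_ed hVs hv) (ed_nonneg hV0 v)
  obtain ⟨n, hn⟩ := pow_unbounded_of_one_lt (R / 16 / (10 * L)) (one_lt_two)
  rw [div_lt_iff₀ (by positivity)] at hn
  obtain ⟨r, hr1, hr2, hr3⟩ := exists_radius_of_decay (f := f) (η := 16 * η) (R := R / 16) hL0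
    (fun r h1 h2 h3 => hdec r h1 h2 (by
      have hr : 0 < r := by linarith
      change 20 * L * f r < c₁ * r
      have : 20 * L * f r ≤ 20 * L * (16 * η * r) := by gcongr
      have h5 : 320 * L * η < c₁ := by nlinarith [mul_pos hL0 hη0]
      nlinarith)) n (R / 16) le_rfl (by linarith)
    ((hfm (by linarith : R / 16 ≤ R)).trans (by change f R ≤ _; linarith))
  have hρr : ρ ≤ r := by
    rcases hr1 with h | h
    · rw [h]; linarith
    · linarith
  by_contra! hbad
  have h1 : c₁ ≤ f ρ := hconc' 0 (mem_ball_self (by positivity)) hbad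
  have h2 := h1.trans ((hfm hρr).trans hr3)
  have h3 : 16 * η * r ≤ 16 * η * (10 * L) := by gcongr
  nlinarith [mul_pos hL0 hη0]

end ClearingOut

section Rescaling

variable {k : ℕ}

theorem exists_smooth_extension {u : E2 → Evec k} (hu : ContDiffOn ℝ (⊤ : ℕ∞) u (ball 0 1)) :
    ∃ w : E2 → Evec k, ContDiff ℝ (⊤ : ℕ∞) w ∧ ∀ x ∈ ball (0 : E2) (15 / 16), w =ᶠ[𝓝 x] u := by
  let χ : ContDiffBump (0 : E2) := ⟨15 / 16, 31 / 32, by norm_num, by norm_num⟩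
  refine ⟨fun x => χ x • u x, contDiff_iff_contDiffAt.2 fun x => ?_, fun x hx => ?_⟩
  · rcases lt_or_ge ‖x‖ 1 with hx | hx
    · have hx' : x ∈ ball (0 : E2) 1 := by simpa using hx
      exact χ.contDiffAt.smul (hu.contDiffAt (isOpen_ball.mem_nhds hx'))
    · have hout : (closedBall (0 : E2) (31 / 32))ᶜ ∈ 𝓝 x := by
        refine isClosed_closedBall.isOpen_compl.mem_nhds ?_
        simp only [Set.mem_compl_iff, mem_closedBall, dist_zero_right, not_le]
        linarith
      have hzero : (fun x => χ x • u x) =ᶠ[𝓝 x] fun _ => (0 : Evec k) := by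
        filter_upwards [hout] with y hy
        have : χ y = 0 := χ.zero_of_le_dist (by
          simp only [Set.mem_compl_iff, mem_closedBall, not_le] at hy
          exact hy.le)
        rw [this, zero_smul]
      exact contDiffAt_const.congr_of_eventuallyEq hzero
  · filter_upwards [isOpen_ball.mem_nhds hx] with y hy
    have : χ y = 1 := χ.one_of_mem_closedBall (ball_subset_closedBall hy)
    rw [this, one_smul]

theorem eDens_eq (V : Evec k → ℝ) (ε : ℝ) (w : E2 → Evec k) (x : E2) :
    eDens V ε w x = ε / 2 * (‖pd w 0 x‖ ^ 2 + ‖pd w 1 x‖ ^ 2) + ε⁻¹ * V (w x) := by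
  unfold eDens gradSq
  rw [Fin.sum_univ_two]
  rfl

theorem eDens_nonneg {V : Evec k → ℝ} (hV0 : ∀ y, 0 ≤ V y) {ε : ℝ} (hε : 0 < ε)
    (w : E2 → Evec k) (x : E2) : 0 ≤ eDens V ε w x := by
  have := hV0 (w x)
  rw [eDens_eq]
  positivity

theorem eDens_congr_of_eventuallyEq (V : Evec k → ℝ) (ε : ℝ) {w u : E2 → Evec k} {x : E2}
    (h : w =ᶠ[𝓝 x] u) : eDens V ε w x = eDens V ε u x := by
  rw [eDens_eq, eDens_eq, pd_congr_of_eventuallyEq h, pd_congr_of_eventuallyEq h, h.eq_of_nhds]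

/-- The blow-up of `w` at the point `z` and scale `ε`. -/
def blowUp (w : E2 → Evec k) (z : E2) (ε : ℝ) (x : E2) : Evec k :=
  w (z + (ε • ContinuousLinearMap.id ℝ E2) x)

theorem contDiff_blowUp {w : E2 → Evec k} (hw : ContDiff ℝ (⊤ : ℕ∞) w) (z : E2) (ε : ℝ) :
    ContDiff ℝ (⊤ : ℕ∞) (blowUp w z ε) :=
  hw.comp (contDiff_const.add (ContinuousLinearMap.contDiff _))

theorem blowUp_apply (w : E2 → Evec k) (z : E2) (ε : ℝ) (x : E2) :
    blowUp w z ε x = w (z + ε • x) := rfl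

theorem laplacian_blowUp {w : E2 → Evec k} (hw : ContDiff ℝ (⊤ : ℕ∞) w) (z : E2) (ε : ℝ)
    (x : E2) : ∑ i, pd (pd (blowUp w z ε) i) i x = ε ^ 2 • ∑ i, pd (pd w i) i (z + ε • x) := by
  rw [Finset.smul_sum]
  refine Finset.sum_congr rfl fun i _ => ?_
  exact pd_pd_comp_affine hw (L := ε • ContinuousLinearMap.id ℝ E2) (s := fun _ => ε)
    (fun j => rfl) z i x

theorem ed_blowUp (V : Evec k → ℝ) {w : E2 → Evec k} (hw : ContDiff ℝ (⊤ : ℕ∞) w) (z : E2) {ε : ℝ}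
    (hε : 0 < ε) (x : E2) : ed V (blowUp w z ε) x = ε * eDens V ε w (z + ε • x) := by
  have h : ∀ i, pd (blowUp w z ε) i x = ε • pd w i (z + ε • x) := fun i =>
    congrFun (pd_comp_affine (diff_of_contDiff hw) (L := ε • ContinuousLinearMap.id ℝ E2)
      (s := fun _ => ε) (fun j => rfl) z i) x
  rw [ed, h, h, blowUp_apply, eDens_eq, norm_smul, norm_smul, Real.norm_eq_abs, abs_of_pos hε]
  field_simp

theorem integral_ed_blowUp (V : Evec k → ℝ) {w : E2 → Evec k} (hw : ContDiff ℝ (⊤ : ℕ∞) w) (z : E2)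
    {ε : ℝ} (hε : 0 < ε) (r : ℝ) :
    ∫ x in ball (0 : E2) r, ed V (blowUp w z ε) x =
      ε⁻¹ * ∫ x in ball z (ε * r), eDens V ε w x := by
  have h1 : ∫ x in ball (0 : E2) r, ed V (blowUp w z ε) x =
      ε * ∫ x in ball (0 : E2) r, eDens V ε w (z + ε • x) := by
    rw [← integral_const_mul]
    exact integral_congr_ae (Eventually.of_forall fun x => ed_blowUp V hw z hε x)
  have h2 := Measure.setIntegral_comp_smul_of_pos volume (fun y => eDens V ε w (z + y))
    (ball (0 : E2) r) hε
  rw [_root_.smul_ball hε.ne', smul_zero, Real.norm_eq_abs, abs_of_pos hε, finrank_euclideanSpace,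
    Fintype.card_fin, smul_eq_mul] at h2
  have h3 := (measurePreserving_add_left volume z).setIntegral_preimage_emb
    (measurableEmbedding_addLeft z) (eDens V ε w) (ball z (ε * r))
  have hpre : (fun y => z + y) ⁻¹' ball z (ε * r) = ball 0 (ε * r) := by
    ext y
    simp [dist_eq_norm]
  rw [hpre] at h3
  rw [h1, h2, h3]
  field_simp

end Rescaling

section Wells

variable {k : ℕ}

/-- A continuous map which is close to the wells on a connected set is close to a single one. -/
theorem exists_unique_well {V : Evec k → ℝ} {μ₀ : ℝ} (hμ₀ : 0 < μ₀)
    (hdisj : ∀ σ σ' : Evec k, V σ = 0 → V σ' = 0 → σ ≠ σ' →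
      Disjoint (ball σ (2 * μ₀)) (ball σ' (2 * μ₀))) {s : Set E2} (hs : IsPreconnected s)
    (hne : s.Nonempty) {w : E2 → Evec k} (hw : ContinuousOn w s)
    (h : ∀ x ∈ s, ∃ σ, V σ = 0 ∧ ‖w x - σ‖ < μ₀ / 2) :
    ∃ σ, V σ = 0 ∧ ∀ x ∈ s, ‖w x - σ‖ ≤ μ₀ / 2 := by
  obtain ⟨x₀, hx₀⟩ := hne
  obtain ⟨σ, hσ, hσx⟩ := h x₀ hx₀
  refine ⟨σ, hσ, fun x hx => ?_⟩
  have hsub : ∀ τ : Evec k, ball τ (μ₀ / 2) ⊆ ball τ (2 * μ₀) := fun τ =>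
    ball_subset_ball (by linarith)
  have hsplit : w '' s ⊆ ball σ (μ₀ / 2) ∪ ⋃ τ ∈ {τ : Evec k | V τ = 0 ∧ τ ≠ σ}, ball τ (μ₀ / 2) := by
    rintro _ ⟨y, hy, rfl⟩
    obtain ⟨τ, hτ, hτy⟩ := h y hy
    by_cases he : τ = σ
    · left
      rw [← he]
      simpa [dist_eq_norm] using hτy
    · right
      exact Set.mem_biUnion (show τ ∈ {τ : Evec k | V τ = 0 ∧ τ ≠ σ} from ⟨hτ, he⟩)
        (by simpa [dist_eq_norm] using hτy)
  have hd : Disjoint (ball σ (μ₀ / 2))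
      (⋃ τ ∈ {τ : Evec k | V τ = 0 ∧ τ ≠ σ}, ball τ (μ₀ / 2)) := by
    refine Set.disjoint_iUnion₂_right.2 fun τ hτ => ?_
    exact (hdisj σ τ hσ hτ.1 hτ.2.symm).mono (hsub σ) (hsub τ)
  have := (hs.image w hw).subset_left_of_subset_union isOpen_ball
    (isOpen_biUnion fun _ _ => isOpen_ball) hd hsplit
    ⟨w x₀, ⟨x₀, hx₀, rfl⟩, by simpa [dist_eq_norm] using hσx⟩ ⟨x, hx, rfl⟩
  rw [mem_ball, dist_eq_norm] at this
  exact this.le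

end Wells

/-- the ε-clearing-out theorem. There are constants
`η₁, C_nrg > 0` depending only on `V` such that any solution on the unit disk
with `E_ε(u_ε, D²) ≤ 2η₁` stays `μ₀/2`-close to a single well `σ ∈ Σ` on
`D²(3/4)` and satisfies `E_ε(u_ε, D²(5/8)) ≤ C_nrg · ε · E_ε(u_ε, D²)`. -/
theorem statement_4 (k : ℕ) (hk : 1 ≤ k) (V : Evec k → ℝ) (hV : IsMultiWell V)
    (μ₀ : ℝ) (hμ₀ : 0 < μ₀)
    (hdisj : ∀ σ σ' : Evec k, V σ = 0 → V σ' = 0 → σ ≠ σ' →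
      Disjoint (ball σ (2 * μ₀)) (ball σ' (2 * μ₀)))
    (hhess : ∀ σ : Evec k, V σ = 0 → ∃ lm lp : ℝ, 0 < lm ∧ lm ≤ lp ∧
      ∀ y ∈ ball σ (2 * μ₀), ∀ w : Evec k,
        lm / 2 * ‖w‖ ^ 2 ≤ iteratedFDeriv ℝ 2 V y ![w, w] ∧
        iteratedFDeriv ℝ 2 V y ![w, w] ≤ 2 * lp * ‖w‖ ^ 2) :
    ∃ η₁ > (0 : ℝ), ∃ Cnrg > (0 : ℝ),
      ∀ ε : ℝ, 0 < ε → ε ≤ 1 →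
      ∀ u : E2 → Evec k, IsSolution V ε (ball (0 : E2) 1) u →
        IntegrableOn (eDens V ε u) (ball (0 : E2) 1) →
        energy V ε u (ball (0 : E2) 1) ≤ 2 * η₁ →
        ∃ σ : Evec k, V σ = 0 ∧
          (∀ x ∈ ball (0 : E2) (3 / 4), ‖u x - σ‖ ≤ μ₀ / 2) ∧
          energy V ε u (ball (0 : E2) (5 / 8)) ≤
            Cnrg * ε * energy V ε u (ball (0 : E2) 1) := by
  have hVs := hV.smooth
  have hV0 := hV.nonneg
  obtain ⟨T, hT, c₀, hc₀, C, hC, hnear, hT1, η, hη, hclear⟩ :=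
    exists_clearing_out hV hμ₀ hdisj hhess (R₀ := 3 / 16) (by norm_num)
  obtain ⟨Cs, hCs, hcut⟩ := exists_cutoff
  have hC0 : 0 < C := by linarith
  refine ⟨3 / 32 * η, by positivity, 16 * Cs * C, by positivity, ?_⟩
  intro ε hε hε1 u hu hint hE
  obtain ⟨w, hw, hwu⟩ := exists_smooth_extension hu.1
  have hsub1 : ball (0 : E2) (15 / 16) ⊆ ball 0 1 := ball_subset_ball (by norm_num)
  have heq : ∀ G ⊆ ball (0 : E2) (15 / 16), MeasurableSet G →
      ∫ x in G, eDens V ε w x = ∫ x in G, eDens V ε u x := fun G hG hGm =>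
    setIntegral_congr_fun hGm fun x hx => eDens_congr_of_eventuallyEq V ε (hwu x (hG hx))
  have hle : ∀ G ⊆ ball (0 : E2) (15 / 16), MeasurableSet G →
      ∫ x in G, eDens V ε w x ≤ energy V ε u (ball 0 1) := fun G hG hGm => by
    rw [heq G hG hGm]
    exact setIntegral_mono_set hint (Eventually.of_forall fun x => eDens_nonneg hV0 hε u x)
      (LE.le.eventuallyLE (hG.trans hsub1))
  have hpde : ∀ (z x : E2), z + ε • x ∈ ball (0 : E2) (15 / 16) →
      ∑ i, pd (pd (blowUp w z ε) i) i x = gradient V (blowUp w z ε x) := by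
    intro z x hx
    have h1 : ∑ i, pd (pd w i) i (z + ε • x) = lap u (z + ε • x) :=
      Finset.sum_congr rfl fun i _ => pd_pd_congr_of_eventuallyEq (hwu _ hx) i
    rw [laplacian_blowUp hw, h1, hu.2 _ (hsub1 hx), smul_inv_smul₀ (by positivity), blowUp_apply,
      (hwu _ hx).eq_of_nhds]
  have hsmall : ∀ z ∈ ball (0 : E2) (3 / 4), V (w z) < c₀ := by
    intro z hz
    have hzs : ball z (3 / 16) ⊆ ball (0 : E2) (15 / 16) :=
      ball_subset_ball' (by rw [mem_ball] at hz; linarith)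
    have h := hclear (3 / 16 / ε) (by rw [ge_iff_le, le_div_iff₀ hε]; linarith) (blowUp w z ε)
      (contDiff_blowUp hw z ε) (fun x hx => hpde z x (hzs (by
        rw [mem_ball, dist_eq_norm, add_sub_cancel_left, norm_smul, Real.norm_eq_abs,
          abs_of_pos hε]
        have : ‖x‖ < 3 / 16 / ε := by simpa using hx
        rw [lt_div_iff₀ hε] at this
        linarith))) (by
        rw [integral_ed_blowUp V hw z hε, mul_div_cancel₀ _ hε.ne']
        have h1 := (hle _ hzs measurableSet_ball).trans hE
        have h2 := mul_le_mul_of_nonneg_left h1 (inv_nonneg.2 hε.le)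
        refine h2.trans (le_of_eq ?_)
        field_simp
        ring)
    simpa [blowUp_apply] using h
  have hsub2 : ball (0 : E2) (3 / 4) ⊆ ball 0 (15 / 16) := ball_subset_ball (by norm_num)
  obtain ⟨σ, hσ, hσw⟩ := exists_unique_well hμ₀ hdisj (convex_ball (0 : E2) (3 / 4)).isPreconnected
    ⟨0, mem_ball_self (by norm_num)⟩ hw.continuous.continuousOn fun x hx => hnear _ (hsmall x hx)
  refine ⟨σ, hσ, fun x hx => ?_, ?_⟩
  · rw [← (hwu x (hsub2 hx)).eq_of_nhds]
    exact hσw x hx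
  have hab : 5 / 8 / ε < 11 / 16 / ε :=
    div_lt_div_of_pos_right (by norm_num) hε
  obtain ⟨ψ, hψs, hψ0, -, hψ1, hψz, hψb, hψz'⟩ := hcut (5 / 8 / ε) (11 / 16 / ε) (by positivity) hab
  have hψc : HasCompactSupport ψ := hasCompactSupport_of_zero_outside hψz
  set v := blowUp w 0 ε with hv
  have hvs : ContDiff ℝ (⊤ : ℕ∞) v := contDiff_blowUp hw 0 ε
  have hscale : ∀ {x : E2}, ‖x‖ < 11 / 16 / ε → (0 : E2) + ε • x ∈ ball (0 : E2) (3 / 4) := by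
    intro x hx
    rw [lt_div_iff₀ hε] at hx
    rw [zero_add, mem_ball_zero_iff, norm_smul, Real.norm_eq_abs, abs_of_pos hε]
    linarith
  have hgood : ∀ {x : E2}, ‖x‖ < 11 / 16 / ε → V (v x) < c₀ := fun hx => hsmall _ (hscale hx)
  have hsupp : ∀ {x}, ψ x ≠ 0 → ‖x‖ < 11 / 16 / ε := fun hx => not_le.1 fun h => hx (hψz _ h)
  have hmem : ∀ {x : E2} {r : ℝ}, x ∈ ball (0 : E2) r → ‖x‖ < r := fun hx => by simpa using hx
  have hcacc := integral_cutoff_ed_le (B := 0) (D := 0) hVs hvs hT hψs hψc hψ0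
    (fun x hx => hpde 0 x (hsub2 (hscale (hsupp hx))))
    (S := ball 0 (11 / 16 / ε)) measurableSet_ball (fun x hx => (hmem hx).le) hC hψb
    (fun i x hx => hψz' i x (Or.inr (by simpa using hx)))
    (fun x hx => (hT1 _ (hgood (hmem hx))).1)
    (fun x hx => by linarith [(hT1 _ (hgood (hsupp hx))).2.1])
    (fun x hx i => by
      have := (hT1 _ (hgood (hsupp hx))).2.2 (pd v i x)
      nlinarith [sq_nonneg ‖pd v i x‖])
  have hlow := setIntegral_le_integral_mul (continuous_ed hVs hvs) (ed_nonneg hV0 v) hψs.continuous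
    hψc hψ0 (S := ball 0 (5 / 8 / ε)) measurableSet_ball (fun x hx => (hmem hx).le)
    (fun x hx => hψ1 x (hmem hx).le)
  rw [zero_add, mul_zero, zero_mul, zero_add] at hcacc
  have h1 := hlow.trans hcacc
  rw [integral_ed_blowUp V hw 0 hε, integral_ed_blowUp V hw 0 hε, mul_div_cancel₀ _ hε.ne',
    mul_div_cancel₀ _ hε.ne', heq _ (ball_subset_ball (by norm_num)) measurableSet_ball] at h1
  have h2 := hle (ball (0 : E2) (11 / 16)) (ball_subset_ball (by norm_num)) measurableSet_ball
  have h3 : Cs / (11 / 16 / ε - 5 / 8 / ε) = 16 * Cs * ε := by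
    field_simp
    norm_num
  rw [h3] at h1
  have h4 := mul_le_mul_of_nonneg_left h1 hε.le
  rw [mul_inv_cancel_left₀ hε.ne'] at h4
  refine h4.trans ?_
  calc ε * (16 * Cs * ε * C * (ε⁻¹ * ∫ x in ball (0 : E2) (11 / 16), eDens V ε w x))
      = 16 * Cs * C * ε * ∫ x in ball (0 : E2) (11 / 16), eDens V ε w x := by
        field_simp
    _ ≤ 16 * Cs * C * ε * energy V ε u (ball 0 1) := by gcongr
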